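/- arXiv:math/0111148 — 2 statements merged into one kernel-verified Lean document; each statement's English description precedes it below -/
import Mathlib

section
/- For all alternating maps A ∈ A^a(V), B ∈ A^b(V), C ∈ A^c(V) one has the insertion identity i_C(A∧B) = (i_C A)∧B + (−1)^{c(a+1)} A∧(i_C B). -/
/-!  Common framework: operations of degree `a ≥ -1` on a vector space `V`
(i.e. `(a+1)`-linear maps `V^{a+1} → V`) are encoded as raw functions
`(ℕ → V) → V` depending only on the first `a+1` entries of the argument
sequence, together with explicit multilinearity/alternation predicates. -/

noncomputable section
open scoped Classical

namespace JacobiRevisited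

/-- Raw operations on `V`: an `n`-ary operation is encoded by its action on
infinite sequences of arguments (using only the first `n` of them). -/
abbrev Op (V : Type*) := (ℕ → V) → V

/-- `A` depends only on the first `n` arguments. -/
def DependsOn {V : Type*} (n : ℕ) (A : Op V) : Prop :=
  ∀ x y : ℕ → V, (∀ i, i < n → x i = y i) → A x = A y

/-- `A` is an `n`-linear map `V^n → V` (encoded on sequences): it depends only on
the first `n` arguments and is `k`-linear in each of them. -/
def IsMultilinearOn (k : Type*) {V : Type*} [Semiring k] [AddCommMonoid V]
    [Module k V] (n : ℕ) (A : Op V) : Prop :=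
  DependsOn n A ∧
    ∀ i, i < n →
      (∀ (x : ℕ → V) (c : k) (v : V),
        A (Function.update x i (c • v)) = c • A (Function.update x i v)) ∧
      (∀ (x : ℕ → V) (v w : V),
        A (Function.update x i (v + w)) =
          A (Function.update x i v) + A (Function.update x i w))

/-- `A` is alternating in its first `n` arguments. -/
def IsAlternatingOn {V : Type*} [Zero V] (n : ℕ) (A : Op V) : Prop :=
  ∀ x : ℕ → V, ∀ i j, i < n → j < n → i ≠ j → x i = x j → A x = 0

/-- The number of arguments of an operation of degree `a` (namely `a+1`). -/
def ar (a : ℤ) : ℕ := (a + 1).toNat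

/-- Membership in `M^a(V)`: an `(a+1)`-linear map `V^{a+1} → V`
(for `a = -1` this is just a constant, i.e. an element of `V`). -/
def MemM (k : Type*) {V : Type*} [Semiring k] [AddCommMonoid V] [Module k V]
    (a : ℤ) (A : Op V) : Prop := IsMultilinearOn k (ar a) A

/-- Membership in `A^a(V)`: an alternating `(a+1)`-linear map `V^{a+1} → V`. -/
def MemA (k : Type*) {V : Type*} [Semiring k] [AddCommMonoid V] [Module k V]
    (a : ℤ) (A : Op V) : Prop :=
  IsMultilinearOn k (ar a) A ∧ IsAlternatingOn (ar a) A

/-- The argument sequence `x_0, …, x_{m-1}, B(x_m,…,x_{m+nB-1}), x_{m+nB}, …`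
(arguments for the outer operation after inserting the `nB`-ary `B`
at slot `m`). -/
def insertArg {V : Type*} (B : Op V) (nB m : ℕ) (x : ℕ → V) : ℕ → V := fun j =>
  if j < m then x j
  else if j = m then B fun i => x (m + i)
  else x (j + nB - 1)

/-- The Gerstenhaber insertion `ι_B A` of `B ∈ M^b(V)` into `A ∈ M^a(V)`:
`ι_B A(x_0,…,x_{a+b}) = Σ_{m=0}^{a} (−1)^{b·m} A(x_0,…,x_{m−1},
B(x_m,…,x_{m+b}), x_{m+b+1},…,x_{a+b})`. -/
def gIns {V : Type*} [AddCommGroup V] (a b : ℤ) (A B : Op V) : Op V := fun x =>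
  ∑ m ∈ Finset.range (ar a),
    (((-1 : ℤˣ) ^ (b * (m : ℤ)) : ℤˣ) : ℤ) • A (insertArg B (ar b) m x)

/-- The Gerstenhaber bracket `[A,B]^G = −ι_A B + (−1)^{ab} ι_B A` of
`A ∈ M^a(V)` and `B ∈ M^b(V)`. -/
def gBracket {V : Type*} [AddCommGroup V] (a b : ℤ) (A B : Op V) : Op V :=
  -(gIns b a B A) + (((-1 : ℤˣ) ^ (a * b) : ℤˣ) : ℤ) • gIns a b A B

/-- The set `S(n-1, p-1)` of unshuffle permutations of `{0,…,n-1}` which are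
strictly increasing on the first `p` positions and on the remaining ones. -/
def Unshuffles (n p : ℕ) : Finset (Equiv.Perm (Fin n)) :=
  Finset.univ.filter fun σ =>
    (∀ i j : Fin n, (i : ℕ) < (j : ℕ) → (j : ℕ) < p → σ i < σ j) ∧
    (∀ i j : Fin n, (i : ℕ) < (j : ℕ) → p ≤ (i : ℕ) → σ i < σ j)

/-- The Nijenhuis–Richardson insertion `i_B A` of the `nB`-ary `B` into the
`nA`-ary `A`:
`i_B A(x_0,…,x_{a+b}) = Σ_{σ ∈ S(a+b,b)} sgn(σ) ·
A(B(x_{σ(0)},…,x_{σ(b)}), x_{σ(b+1)},…,x_{σ(a+b)})`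
(and `i_B A = 0` when `A` has degree `-1`, i.e. no argument slots). -/
def nrIns {V : Type*} [AddCommGroup V] (nA nB : ℕ) (A B : Op V) : Op V := fun x =>
  if hA : nA = 0 then 0
  else
    ∑ σ ∈ Unshuffles (nA + nB - 1) nB,
      ((Equiv.Perm.sign σ : ℤˣ) : ℤ) •
        A fun j =>
          if hj0 : j = 0 then
            B fun i => if hi : i < nB then x (σ ⟨i, by omega⟩) else 0
          else if hj : j < nA then x (σ ⟨nB + j - 1, by omega⟩) else 0

/-- The Nijenhuis–Richardson bracket `[A,B]^{NR} = −i_A B + (−1)^{ab} i_B A`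
of `A ∈ A^a(V)` and `B ∈ A^b(V)`. -/
def nrBracket {V : Type*} [AddCommGroup V] (a b : ℤ) (A B : Op V) : Op V :=
  -(nrIns (ar b) (ar a) B A) +
    (((-1 : ℤˣ) ^ (a * b) : ℤˣ) : ℤ) • nrIns (ar a) (ar b) A B

/-- The wedge product `A∧B` of the `nA`-ary `A` and the `nB`-ary `B`
(over a commutative algebra `V`):
`(A∧B)(x_0,…,x_{a+b+1}) = Σ_σ sgn(σ) · A(x_{σ(0)},…,x_{σ(a)}) ·
B(x_{σ(a+1)},…,x_{σ(a+b+1)})` summed over unshuffles. -/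
def wedge {V : Type*} [CommRing V] (nA nB : ℕ) (A B : Op V) : Op V := fun x =>
  ∑ σ ∈ Unshuffles (nA + nB) nA,
    ((Equiv.Perm.sign σ : ℤˣ) : ℤ) •
      (A (fun i => if hi : i < nA then x (σ ⟨i, by omega⟩) else 0) *
        B fun j => if hj : j < nB then x (σ ⟨nA + j, by omega⟩) else 0)

/-- The argument sequence `v, x_0, x_1, …`. -/
def consV {V : Type*} (v : V) (x : ℕ → V) : ℕ → V := fun n =>
  if n = 0 then v else x (n - 1)

/-- The argument sequence `v, w, 0, 0, …` (for applying binary operations). -/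
def duo {V : Type*} [Zero V] (v w : V) : ℕ → V := fun n =>
  if n = 0 then v else if n = 1 then w else 0

/-- Membership in `ADer^a(V)`: an alternating `(a+1)`-linear map which (for
`a ≥ 0`) is a derivation in its first (hence, by skew-symmetry, in each)
argument; `ADer^{-1}(V) = V`. -/
def MemADer (k : Type*) {V : Type*} [CommRing k] [CommRing V] [Algebra k V]
    (a : ℤ) (A : Op V) : Prop :=
  IsMultilinearOn k (ar a) A ∧ IsAlternatingOn (ar a) A ∧
    (0 ≤ a → ∀ (f g : V) (x : ℕ → V),
      A (consV (f * g) x) = f * A (consV g x) + g * A (consV f x))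

/-- Membership in `ADiff_1^a(V)`: an alternating `(a+1)`-linear map which (for
`a ≥ 0`) is a first-order differential operator in its first (hence in each)
argument; `ADiff_1^{-1}(V) = V`. -/
def MemADiff1 (k : Type*) {V : Type*} [CommRing k] [CommRing V] [Algebra k V]
    (a : ℤ) (A : Op V) : Prop :=
  IsMultilinearOn k (ar a) A ∧ IsAlternatingOn (ar a) A ∧
    (0 ≤ a → ∀ (f g : V) (x : ℕ → V),
      A (consV (f * g) x) =
        f * A (consV g x) + g * A (consV f x) - f * g * A (consV 1 x))

/-- `D : V → V` is a differential operator of order `≤ n` on the commutative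
algebra `V`. -/
def DiffOrderLe {V : Type*} [CommRing V] : ℕ → (V → V) → Prop
  | 0 => fun D => ∀ f x, D (f * x) = f * D x
  | n + 1 => fun D => ∀ f : V, DiffOrderLe n fun x => D (f * x) - f * D x

/-- Membership in `ADiff^a(V)`: an alternating `(a+1)`-linear map which is a
differential operator of some finite order in each argument separately
(the other arguments being fixed); `ADiff^{-1}(V) = V`. -/
def MemADiff (k : Type*) {V : Type*} [CommRing k] [CommRing V] [Algebra k V]
    (a : ℤ) (A : Op V) : Prop :=
  IsMultilinearOn k (ar a) A ∧ IsAlternatingOn (ar a) A ∧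
    ∀ i, i < ar a → ∃ n, ∀ x : ℕ → V,
      DiffOrderLe n fun v => A (Function.update x i v)

/-- The identity map `I ∈ A^0(V)`. -/
def Iop {V : Type*} : Op V := fun x => x 0

/-- The insertion `i_1 A` of the unit `1 ∈ V = A^{-1}(V)` into `A ∈ A^a(V)`;
for `a ≥ 0` this is `A(1,·,…,·)`. -/
def iUnit {V : Type*} [CommRing V] (a : ℤ) (A : Op V) : Op V :=
  nrIns (ar a) 0 A fun _ => 1

/-- Application of a degree-0 (i.e. unary) operation to an element of `V`. -/
def app1 {V : Type*} (X : Op V) (v : V) : V := X fun _ => v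

/-- The commutator `X∘Y − Y∘X` of two degree-0 operations. -/
def commOp {V : Type*} [AddCommGroup V] (X Y : Op V) : Op V := fun x =>
  app1 X (app1 Y (x 0)) - app1 Y (app1 X (x 0))

/-- The iterated wedge product `X_1 ∧ … ∧ X_m` of a list of degree-0
operations (with the empty product being the unit `1 ∈ V = A^{-1}(V)`). -/
def wedgeList {V : Type*} [CommRing V] : List (Op V) → Op V
  | [] => fun _ => 1
  | X :: l => wedge 1 l.length X (wedgeList l)


theorem DependsOn.congr {V : Type*} {n : ℕ} {A : Op V} (hA : DependsOn n A) {x y : ℕ → V}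
    (h : ∀ i, i < n → x i = y i) : A x = A y := hA x y h

/-- The extension of a permutation of `Fin n` to `ℕ` by the identity. -/
def extendNat {n : ℕ} (σ : Equiv.Perm (Fin n)) (i : ℕ) : ℕ :=
  if h : i < n then σ ⟨i, h⟩ else i

/-- The extension of a permutation of `Fin n`, moved to the interval `[s, s + n)`, to `ℕ`. -/
def extendShift {n : ℕ} (s : ℕ) (σ : Equiv.Perm (Fin n)) (i : ℕ) : ℕ :=
  if i < s then i else s + extendNat σ (i - s)

theorem extendNat_of_lt {n : ℕ} (σ : Equiv.Perm (Fin n)) {i : ℕ} (h : i < n) :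
    extendNat σ i = σ ⟨i, h⟩ := dif_pos h

theorem extendNat_of_le {n : ℕ} (σ : Equiv.Perm (Fin n)) {i : ℕ} (h : n ≤ i) :
    extendNat σ i = i := dif_neg h.not_gt

theorem extendNat_mul {n : ℕ} (σ τ : Equiv.Perm (Fin n)) :
    extendNat (σ * τ) = extendNat σ ∘ extendNat τ := by
  funext i
  by_cases h : i < n <;> simp [extendNat, h]

theorem extendNat_one {n : ℕ} (i : ℕ) : extendNat (1 : Equiv.Perm (Fin n)) i = i := by
  by_cases h : i < n <;> simp [extendNat, h]

theorem extendShift_zero {n : ℕ} (σ : Equiv.Perm (Fin n)) : extendShift 0 σ = extendNat σ := by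
  funext i
  simp [extendShift]

theorem extendShift_add {n : ℕ} (s : ℕ) (σ : Equiv.Perm (Fin n)) (i : ℕ) :
    extendShift s σ (s + i) = s + extendNat σ i := by
  simp [extendShift]

theorem extendShift_of_lt {n : ℕ} (s : ℕ) (σ : Equiv.Perm (Fin n)) {i : ℕ} (h : i < s) :
    extendShift s σ i = i := if_pos h

theorem extendShift_of_le {n : ℕ} (s : ℕ) (σ : Equiv.Perm (Fin n)) {i : ℕ} (h : s + n ≤ i) :
    extendShift s σ i = i := by
  rw [extendShift, if_neg (by omega), extendNat_of_le _ (by omega)]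
  omega

theorem exists_extendNat_eq_extendShift {p n : ℕ} (s : ℕ) (h : s + p ≤ n)
    (ρ : Equiv.Perm (Fin p)) :
    ∃ τ : Equiv.Perm (Fin n), extendNat τ = extendShift s ρ ∧
      Equiv.Perm.sign τ = Equiv.Perm.sign ρ := by
  let f : Fin p ↪ Fin n := ⟨fun i => ⟨s + i, by omega⟩, fun i j hij => by
    ext
    simpa using hij⟩
  refine ⟨ρ.viaFintypeEmbedding f, ?_, Equiv.Perm.viaFintypeEmbedding_sign _ _⟩
  funext i
  by_cases hi : s ≤ i ∧ i < s + p
  · obtain ⟨j, rfl⟩ := Nat.exists_eq_add_of_le hi.1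
    have hj : j < p := by omega
    rw [extendShift_add, extendNat_of_lt _ hj, extendNat_of_lt _ (by omega)]
    exact congrArg Fin.val (Equiv.Perm.viaFintypeEmbedding_apply_image ρ f ⟨j, hj⟩)
  · have hs : extendShift s ρ i = i := by
      rcases Nat.lt_or_ge i s with h' | h'
      · exact extendShift_of_lt _ _ h'
      · exact extendShift_of_le _ _ (by omega)
    rw [hs]
    by_cases hn : i < n
    · rw [extendNat_of_lt _ hn, Equiv.Perm.viaFintypeEmbedding_apply_notMem_range]
      rintro ⟨j, hj⟩
      have : s + (j : ℕ) = i := congrArg Fin.val hj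
      omega
    · exact extendNat_of_le _ (by omega)

/-- The rotation of `Fin (a + b)` exchanging the two blocks. -/
theorem exists_block_rotation (a b : ℕ) :
    ∃ γ : Equiv.Perm (Fin (a + b)), Equiv.Perm.sign γ = (-1) ^ (a * b) ∧
      (∀ i < a, extendNat γ i = b + i) ∧ ∀ j < b, extendNat γ (a + j) = j := by
  rcases Nat.eq_zero_or_pos (a + b) with h | h
  · obtain ⟨rfl, rfl⟩ : a = 0 ∧ b = 0 := by omega
    exact ⟨1, by simp, by simp, by simp⟩
  obtain ⟨n, hn⟩ : ∃ n, a + b = n + 1 := ⟨a + b - 1, by omega⟩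
  rw [hn]
  have hpow : ∀ (m i : ℕ) (hi : i < n + 1),
      (((finRotate (n + 1)) ^ m) ⟨i, hi⟩ : ℕ) = (i + m) % (n + 1) := by
    intro m
    induction m with
    | zero => intro i hi; simp [Nat.mod_eq_of_lt hi]
    | succ m ih =>
      intro i hi
      rw [pow_succ', Equiv.Perm.mul_apply, finRotate_apply, Fin.val_add, ih, Fin.val_one',
        ← Nat.add_mod, add_assoc]
  refine ⟨finRotate (n + 1) ^ b, ?_, ?_, ?_⟩
  · rw [map_pow, sign_finRotate, ← pow_mul]
    rcases Nat.eq_zero_or_pos b with rfl | hb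
    · simp
    obtain ⟨m, rfl⟩ : ∃ m, b = m + 1 := ⟨b - 1, by omega⟩
    obtain rfl : n = a + m := by omega
    rw [Nat.add_sub_cancel, add_mul, pow_add, (Nat.even_mul_succ_self m).neg_one_pow, mul_one]
  · intro i hi
    rw [extendNat_of_lt _ (by omega), hpow, Nat.mod_eq_of_lt (by omega), add_comm]
  · intro j hj
    rw [extendNat_of_lt _ (by omega), hpow, show a + j + b = j + (n + 1) by omega,
      Nat.add_mod_right, Nat.mod_eq_of_lt (by omega)]

/-- The permutation of `Fin (p + q)` acting by `ρ` and `τ` on the two blocks. -/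
def blockPerm {p q : ℕ} (ρ : Equiv.Perm (Fin p)) (τ : Equiv.Perm (Fin q)) :
    Equiv.Perm (Fin (p + q)) :=
  finSumFinEquiv.permCongr (Equiv.Perm.sumCongr ρ τ)

theorem blockPerm_castAdd {p q : ℕ} (ρ : Equiv.Perm (Fin p)) (τ : Equiv.Perm (Fin q))
    (i : Fin p) : blockPerm ρ τ (Fin.castAdd q i) = Fin.castAdd q (ρ i) := by
  simp [blockPerm, Equiv.permCongr_apply]

theorem blockPerm_natAdd {p q : ℕ} (ρ : Equiv.Perm (Fin p)) (τ : Equiv.Perm (Fin q))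
    (i : Fin q) : blockPerm ρ τ (Fin.natAdd p i) = Fin.natAdd p (τ i) := by
  simp [blockPerm, Equiv.permCongr_apply]

theorem sign_blockPerm {p q : ℕ} (ρ : Equiv.Perm (Fin p)) (τ : Equiv.Perm (Fin q)) :
    Equiv.Perm.sign (blockPerm ρ τ) = Equiv.Perm.sign ρ * Equiv.Perm.sign τ := by
  simp [blockPerm]

theorem extendNat_blockPerm {p q : ℕ} (ρ : Equiv.Perm (Fin p)) (τ : Equiv.Perm (Fin q)) :
    extendNat (blockPerm ρ τ) = extendShift 0 ρ ∘ extendShift p τ := by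
  funext i
  rw [extendShift_zero, Function.comp_apply]
  rcases Nat.lt_or_ge i p with h | h
  · rw [extendShift_of_lt _ _ h, extendNat_of_lt _ (by omega), extendNat_of_lt _ h]
    exact congrArg Fin.val (blockPerm_castAdd ρ τ ⟨i, h⟩)
  obtain ⟨j, rfl⟩ := Nat.exists_eq_add_of_le h
  rw [extendShift_add, extendNat_of_le ρ (by omega)]
  rcases Nat.lt_or_ge j q with hj | hj
  · rw [extendNat_of_lt _ (by omega), extendNat_of_lt _ hj]
    exact congrArg Fin.val (blockPerm_natAdd ρ τ ⟨j, hj⟩)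
  · rw [extendNat_of_le _ (by omega), extendNat_of_le _ hj]

theorem mem_unshuffles_iff {p q : ℕ} (σ : Equiv.Perm (Fin (p + q))) :
    σ ∈ Unshuffles (p + q) p ↔
      StrictMono (σ ∘ Fin.castAdd q) ∧ StrictMono (σ ∘ Fin.natAdd p) := by
  simp only [Unshuffles, Finset.mem_filter, Finset.mem_univ, true_and]
  constructor
  · rintro ⟨h₁, h₂⟩
    exact ⟨fun i j hij => h₁ _ _ hij j.2, fun i j hij =>
      h₂ _ _ (by simpa using hij) (by simp)⟩
  · rintro ⟨h₁, h₂⟩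
    constructor
    · intro i j hij hj
      exact @h₁ ⟨i, by omega⟩ ⟨j, hj⟩ hij
    · intro i j hij hi
      have := @h₂ ⟨i - p, by omega⟩ ⟨j - p, by omega⟩ (by simp only [Fin.mk_lt_mk]; omega)
      simpa [Fin.natAdd, Nat.add_sub_cancel' hi, Nat.add_sub_cancel' (hi.trans hij.le)] using this

theorem strictMono_comp_sort {n : ℕ} {α : Type*} [LinearOrder α] {f : Fin n → α}
    (hf : Function.Injective f) : StrictMono (f ∘ Tuple.sort f) :=
  (Tuple.monotone_sort f).strictMono_of_injective (hf.comp (Tuple.sort f).injective)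

theorem StrictMono.eq_of_comp_perm_eq {n : ℕ} {α : Type*} [LinearOrder α] {f g : Fin n → α}
    (hf : StrictMono f) (hg : StrictMono g) {ρ τ : Equiv.Perm (Fin n)}
    (h : f ∘ ρ = g ∘ τ) : f = g ∧ ρ = τ := by
  have hfg : f = g := by
    rw [← hf.range_inj hg, ← ρ.surjective.range_comp f, h, τ.surjective.range_comp]
  subst hfg
  exact ⟨rfl, Equiv.ext fun i => hf.injective (congrFun h i)⟩

theorem sum_perm_eq_sum_unshuffles {M : Type*} [AddCommMonoid M] (p q : ℕ)
    (f : Equiv.Perm (Fin (p + q)) → M) :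
    ∑ σ, f σ = ∑ u ∈ Unshuffles (p + q) p, ∑ ρ : Equiv.Perm (Fin p) × Equiv.Perm (Fin q),
      f (u * blockPerm ρ.1 ρ.2) := by
  rw [← Finset.sum_product']
  symm
  refine Finset.sum_nbij (fun t => t.1 * blockPerm t.2.1 t.2.2) (by simp) ?_ ?_ (by simp)
  · rintro ⟨u, ρ, τ⟩ hu ⟨u', ρ', τ'⟩ hu' h
    simp only [Finset.coe_product, Set.mem_prod, Finset.mem_coe, mem_unshuffles_iff] at hu hu'
    have h₁ := StrictMono.eq_of_comp_perm_eq hu.1.1 hu'.1.1 (ρ := ρ) (τ := ρ') (by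
      funext i
      simpa [blockPerm_castAdd] using Equiv.congr_fun h (Fin.castAdd q i))
    have h₂ := StrictMono.eq_of_comp_perm_eq hu.1.2 hu'.1.2 (ρ := τ) (τ := τ') (by
      funext i
      simpa [blockPerm_natAdd] using Equiv.congr_fun h (Fin.natAdd p i))
    have hu : u = u' := by
      ext i : 1
      induction i using Fin.addCases with
      | left i => exact congrFun h₁.1 i
      | right i => exact congrFun h₂.1 i
    rw [hu, h₁.2, h₂.2]
  · intro σ _
    set ρ := Tuple.sort (σ ∘ Fin.castAdd q) with hρ
    set τ := Tuple.sort (σ ∘ Fin.natAdd p) with hτ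
    refine ⟨(σ * blockPerm ρ τ, ρ⁻¹, τ⁻¹), ?_, ?_⟩
    · simp only [Finset.coe_product, Set.mem_prod, Finset.mem_coe, mem_unshuffles_iff,
        Finset.mem_univ, and_true]
      constructor
      · convert strictMono_comp_sort (σ.injective.comp (Fin.castAdd_injective p q)) using 1
        funext i
        simp [blockPerm_castAdd, hρ]
      · convert strictMono_comp_sort (σ.injective.comp (Fin.natAdd_injective q p)) using 1
        funext i
        simp [blockPerm_natAdd, hτ]
    · ext i : 1
      induction i using Fin.addCases with
      | left i => simp [blockPerm_castAdd]
      | right i => simp [blockPerm_natAdd]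

/-- `G` changes by the sign under permutations of the arguments in `[s, s + n)`. -/
def SkewOn {V : Type*} [AddCommGroup V] (s n : ℕ) (G : Op V) : Prop :=
  ∀ (ρ : Equiv.Perm (Fin n)) (y : ℕ → V),
    G (y ∘ extendShift s ρ) = ((Equiv.Perm.sign ρ : ℤˣ) : ℤ) • G y

/-- The full antisymmetrization of `G` in its first `n` arguments. -/
def altSum {V : Type*} [AddCommGroup V] (n : ℕ) (G : Op V) : Op V := fun x =>
  ∑ σ : Equiv.Perm (Fin n), ((Equiv.Perm.sign σ : ℤˣ) : ℤ) • G (x ∘ extendNat σ)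

/-- The antisymmetrization of `G` over unshuffles. -/
def unshuffleSum {V : Type*} [AddCommGroup V] (n p : ℕ) (G : Op V) : Op V := fun x =>
  ∑ σ ∈ Unshuffles n p, ((Equiv.Perm.sign σ : ℤˣ) : ℤ) • G (x ∘ extendNat σ)

theorem sign_smul_sign_smul {V : Type*} [AddCommGroup V] (u : ℤˣ) (v : V) :
    (u : ℤ) • (u : ℤ) • v = v := by
  rw [smul_smul, ← Units.val_mul, Int.units_mul_self, Units.val_one, one_smul]

theorem altSum_eq_unshuffleSum {V : Type*} [AddCommGroup V] {p q : ℕ} {G : Op V}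
    (h₁ : SkewOn 0 p G) (h₂ : SkewOn p q G) (x : ℕ → V) :
    altSum (p + q) G x = (p.factorial * q.factorial) • unshuffleSum (p + q) p G x := by
  rw [altSum, sum_perm_eq_sum_unshuffles, unshuffleSum, Finset.smul_sum]
  refine Finset.sum_congr rfl fun u _ => ?_
  have : ∀ ρ : Equiv.Perm (Fin p) × Equiv.Perm (Fin q),
      ((Equiv.Perm.sign (u * blockPerm ρ.1 ρ.2) : ℤˣ) : ℤ) •
        G (x ∘ extendNat (u * blockPerm ρ.1 ρ.2)) =
      ((Equiv.Perm.sign u : ℤˣ) : ℤ) • G (x ∘ extendNat u) := by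
    intro ρ
    rw [extendNat_mul, extendNat_blockPerm, ← Function.comp_assoc, ← Function.comp_assoc, h₂, h₁,
      smul_smul _ _ (G _), ← Units.val_mul, mul_comm (Equiv.Perm.sign ρ.2), ← sign_blockPerm,
      map_mul, Units.val_mul, mul_smul, sign_smul_sign_smul]
  rw [Finset.sum_congr rfl fun ρ _ => this ρ, Finset.sum_const, Finset.card_univ,
    Fintype.card_prod, Fintype.card_perm, Fintype.card_perm, Fintype.card_fin, Fintype.card_fin]

theorem altSum_comp_extendNat {V : Type*} [AddCommGroup V] {n : ℕ} (G : Op V)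
    (ρ : Equiv.Perm (Fin n)) (x : ℕ → V) :
    altSum n (fun y => G (y ∘ extendNat ρ)) x =
      ((Equiv.Perm.sign ρ : ℤˣ) : ℤ) • altSum n G x := by
  rw [altSum, altSum, Finset.smul_sum]
  refine Fintype.sum_equiv (Equiv.mulRight ρ) _ _ fun σ => ?_
  rw [Equiv.coe_mulRight, extendNat_mul, map_mul, mul_comm, Units.val_mul, mul_smul,
    sign_smul_sign_smul]
  rfl

theorem altSum_comp_extendShift {V : Type*} [AddCommGroup V] {n p s : ℕ} (h : s + p ≤ n)
    (G : Op V) (ρ : Equiv.Perm (Fin p)) (x : ℕ → V) :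
    altSum n (fun y => G (y ∘ extendShift s ρ)) x =
      ((Equiv.Perm.sign ρ : ℤˣ) : ℤ) • altSum n G x := by
  obtain ⟨τ, hτ, hs⟩ := exists_extendNat_eq_extendShift s h ρ
  rw [← hτ, ← hs, altSum_comp_extendNat]

theorem skewOn_altSum {V : Type*} [AddCommGroup V] (n : ℕ) (G : Op V) :
    SkewOn 0 n (altSum n G) := by
  intro ρ y
  rw [extendShift_zero, altSum, altSum, Finset.smul_sum]
  refine Fintype.sum_equiv (Equiv.mulLeft ρ) _ _ fun σ => ?_
  rw [Equiv.coe_mulLeft, extendNat_mul, map_mul, Units.val_mul, mul_smul, sign_smul_sign_smul]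
  rfl

theorem altSum_smul {V : Type*} [AddCommGroup V] (n m : ℕ) (G : Op V) (x : ℕ → V) :
    altSum n (fun y => m • G y) x = m • altSum n G x := by
  simp only [altSum, Finset.smul_sum]
  exact Finset.sum_congr rfl fun σ _ => smul_comm _ _ _

theorem altSum_zsmul {V : Type*} [AddCommGroup V] (n : ℕ) (m : ℤ) (G : Op V) (x : ℕ → V) :
    altSum n (fun y => m • G y) x = m • altSum n G x := by
  simp only [altSum, Finset.smul_sum]
  exact Finset.sum_congr rfl fun σ _ => smul_comm _ _ _

theorem altSum_sum {V ι : Type*} [AddCommGroup V] (n : ℕ) (s : Finset ι) (G : ι → Op V)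
    (x : ℕ → V) :
    altSum n (fun y => ∑ i ∈ s, G i y) x = ∑ i ∈ s, altSum n (G i) x := by
  simp only [altSum, Finset.smul_sum]
  exact Finset.sum_comm

theorem altSum_sum_extendShift {V : Type*} [AddCommGroup V] {n p s : ℕ} (h : s + p ≤ n)
    (G : Op V) (x : ℕ → V) :
    altSum n (fun y => ∑ ρ : Equiv.Perm (Fin p),
      ((Equiv.Perm.sign ρ : ℤˣ) : ℤ) • G (y ∘ extendShift s ρ)) x =
      p.factorial • altSum n G x := by
  rw [altSum_sum]
  simp only [altSum_zsmul, altSum_comp_extendShift h, sign_smul_sign_smul]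
  simp [Fintype.card_perm]

/-- `A` is a skew-symmetric function of its first `n` arguments. -/
def IsSkew {V : Type*} [AddCommGroup V] (n : ℕ) (A : Op V) : Prop :=
  DependsOn n A ∧ SkewOn 0 n A

theorem IsSkew.map_comp {V : Type*} [AddCommGroup V] {n : ℕ} {A : Op V} (hA : IsSkew n A)
    (ρ : Equiv.Perm (Fin n)) (y : ℕ → V) :
    A (y ∘ extendNat ρ) = ((Equiv.Perm.sign ρ : ℤˣ) : ℤ) • A y := by
  rw [← extendShift_zero, hA.2]

theorem isSkew_of_memA {k V : Type*} [Field k] [AddCommGroup V] [Module k V] {a : ℤ} {A : Op V}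
    (hA : MemA k a A) : IsSkew (ar a) A := by
  obtain ⟨⟨hdep, hlin⟩, halt⟩ := hA
  refine ⟨hdep, fun ρ y => ?_⟩
  have hupd : ∀ [DecidableEq (Fin (ar a))] (v : Fin (ar a) → V) (i : Fin (ar a)) (w : V),
      (fun j : ℕ => if h : j < ar a then Function.update v i w ⟨j, h⟩ else 0) =
        Function.update (fun j : ℕ => if h : j < ar a then v ⟨j, h⟩ else 0) i w := by
    intro _ v i w
    funext j
    by_cases hj : j = i
    · subst hj
      simp
    · by_cases h : j < ar a
      · have : (⟨j, h⟩ : Fin (ar a)) ≠ i := fun h' => hj (congrArg Fin.val h')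
        simp [h, hj, this]
      · simp [h, hj]
  let f : V [⋀^Fin (ar a)]→ₗ[k] V :=
    { toFun := fun v => A fun j => if h : j < ar a then v ⟨j, h⟩ else 0
      map_update_add' := fun v i w w' => by
        simp only [hupd]
        exact (hlin i i.2).2 _ _ _
      map_update_smul' := fun v i c w => by
        simp only [hupd]
        exact (hlin i i.2).1 _ _ _
      map_eq_zero_of_eq' := fun v i j hv hij =>
        halt _ i j i.2 j.2 (fun h => hij (Fin.ext h)) (by simpa using hv) }
  have hf : ∀ z : ℕ → V, A z = f fun i => z i := fun z => hdep.congr fun i hi => by simp [hi]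
  rw [hf, hf]
  have := f.map_perm (fun i => y i) ρ
  rw [Units.smul_def] at this
  rw [← this]
  congr 1
  funext i
  simp [extendShift_zero, extendNat_of_lt]

/-- Negating one of the first `n` arguments of `A` negates its value. -/
def OddOn {V : Type*} [AddCommGroup V] (n : ℕ) (A : Op V) : Prop :=
  ∀ i, i < n → ∀ (y : ℕ → V) (v : V),
    A (Function.update y i (-v)) = -A (Function.update y i v)

theorem oddOn_of_isMultilinearOn {k V : Type*} [Ring k] [AddCommGroup V] [Module k V] {n : ℕ}
    {A : Op V} (hA : IsMultilinearOn k n A) : OddOn n A := by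
  intro i hi y v
  simpa using (hA.2 i hi).1 y (-1) v

theorem OddOn.map_consV_neg {V : Type*} [AddCommGroup V] {n : ℕ} {A : Op V}
    (hA : OddOn (n + 1) A) (v : V) (y : ℕ → V) : A (consV (-v) y) = -A (consV v y) := by
  have h : ∀ w, consV w y = Function.update (consV 0 y) 0 w := by
    intro w
    funext j
    rcases j with _ | j <;> simp [consV]
  rw [h, h v, hA 0 n.succ_pos]

theorem oddOn_altSum {V : Type*} [AddCommGroup V] {n : ℕ} {G : Op V} (hG : OddOn n G) :
    OddOn n (altSum n G) := by
  intro i hi y v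
  have h : ∀ (σ : Equiv.Perm (Fin n)) (w : V), Function.update y i w ∘ extendNat σ =
      Function.update (y ∘ extendNat σ) (extendNat σ⁻¹ i) w := by
    intro σ w
    funext j
    have hij : extendNat σ j = i ↔ j = extendNat σ⁻¹ i := by
      have h₁ := congrFun (extendNat_mul σ σ⁻¹) i
      have h₂ := congrFun (extendNat_mul σ⁻¹ σ) j
      simp only [mul_inv_cancel, inv_mul_cancel, extendNat_one, Function.comp_apply] at h₁ h₂
      exact ⟨fun h => by rw [← h, ← h₂], fun h => by rw [h, ← h₁]⟩
    simp only [Function.comp_apply, Function.update_apply, hij]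
  simp only [altSum, h, ← Finset.sum_neg_distrib, ← smul_neg]
  refine Finset.sum_congr rfl fun σ _ => ?_
  rw [hG _ (by rw [extendNat_of_lt _ hi]; exact Fin.is_lt _)]

theorem oddOn_of_nsmul {V : Type*} [AddCommGroup V] [IsAddTorsionFree V] {n m : ℕ} (hm : m ≠ 0)
    {G : Op V} (hG : OddOn n fun y => m • G y) : OddOn n G := by
  intro i hi y v
  apply nsmul_right_injective hm
  have := hG i hi y v
  rwa [← smul_neg] at this

theorem skewOn_of_nsmul {V : Type*} [AddCommGroup V] [IsAddTorsionFree V] {s n m : ℕ} (hm : m ≠ 0)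
    {G : Op V} (hG : SkewOn s n fun y => m • G y) : SkewOn s n G := by
  intro ρ y
  apply nsmul_right_injective hm
  have := hG ρ y
  rw [smul_comm] at this
  exact this

theorem consV_comp_extendShift {V : Type*} {m : ℕ} (r : ℕ) (v : V) (y : ℕ → V)
    (ρ : Equiv.Perm (Fin m)) :
    consV v (fun j => (y ∘ extendShift r ρ) (r + j)) =
      consV v (fun j => y (r + j)) ∘ extendShift 1 ρ := by
  funext j
  rcases j with _ | j
  · simp [consV, extendShift_of_lt]
  · rw [Function.comp_apply, add_comm j 1, extendShift_add]
    simp [consV, extendShift_add]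

theorem SkewOn.of_succ {V : Type*} [AddCommGroup V] {m : ℕ} {A : Op V}
    (hA : SkewOn 0 (m + 1) A) : SkewOn 1 m A := by
  intro ρ y
  obtain ⟨τ, hτ, hs⟩ := exists_extendNat_eq_extendShift 1 (add_comm 1 m).le ρ
  rw [← hτ, ← hs, ← extendShift_zero, hA]

section Products

variable {V : Type*} [CommRing V]

theorem dependsOn_wedge (p q : ℕ) (A B : Op V) : DependsOn (p + q) (wedge p q A B) := by
  intro x y h
  simp only [wedge, h _ (Fin.is_lt _)]

theorem dependsOn_nrIns (m r : ℕ) (A C : Op V) : DependsOn (r + m) (nrIns (m + 1) r A C) := by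
  intro x y h
  have h' : ∀ i : Fin (m + 1 + r - 1), x i = y i := fun i => h i (by omega)
  simp only [nrIns, h']

theorem wedge_eq_unshuffleSum {p q : ℕ} {A B : Op V} (hA : DependsOn p A) (hB : DependsOn q B)
    (x : ℕ → V) :
    wedge p q A B x =
      unshuffleSum (p + q) p (fun y => A y * B fun j => y (p + j)) x := by
  refine Finset.sum_congr rfl fun σ _ => ?_
  congr 2
  · exact hA.congr fun i hi => by simp [hi, extendNat_of_lt σ (show i < p + q by omega)]
  · exact hB.congr fun i hi => by simp [hi, extendNat_of_lt σ (show p + i < p + q by omega)]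

theorem nrIns_eq_unshuffleSum {m r : ℕ} {A C : Op V} (hA : DependsOn (m + 1) A)
    (hC : DependsOn r C) (x : ℕ → V) :
    nrIns (m + 1) r A C x =
      unshuffleSum (r + m) r (fun y => A (consV (C y) fun j => y (r + j))) x := by
  rw [show r + m = m + 1 + r - 1 by omega, nrIns, dif_neg (by omega)]
  refine Finset.sum_congr rfl fun σ _ => ?_
  congr 1
  refine hA.congr fun j hj => ?_
  rcases Nat.eq_zero_or_pos j with rfl | hj0
  · simp only [consV, if_true, dite_true]
    exact hC.congr fun i hi => by
      simp [hi, extendNat_of_lt σ (show i < m + 1 + r - 1 by omega)]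
  · have h : r + (j - 1) < m + 1 + r - 1 := by omega
    simp [consV, hj0.ne', hj, extendNat_of_lt σ h, Nat.add_sub_assoc hj0]

theorem skewOn_mul_left {p : ℕ} {A : Op V} (B : Op V) (hA : SkewOn 0 p A) :
    SkewOn 0 p fun y => A y * B fun j => y (p + j) := by
  intro ρ y
  have : (fun j => (y ∘ extendShift 0 ρ) (p + j)) = fun j => y (p + j) := by
    funext j
    simp [extendShift_of_le 0 ρ (show 0 + p ≤ p + j by omega)]
  simp only [this, hA ρ y, smul_mul_assoc]

theorem skewOn_mul_right {p q : ℕ} {A B : Op V} (hA : DependsOn p A) (hB : IsSkew q B) :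
    SkewOn p q fun y => A y * B fun j => y (p + j) := by
  intro ρ y
  have h₁ : A (y ∘ extendShift p ρ) = A y :=
    hA.congr fun i hi => by simp [extendShift_of_lt p ρ hi]
  have h₂ : (fun j => (y ∘ extendShift p ρ) (p + j)) = (fun j => y (p + j)) ∘ extendNat ρ := by
    funext j
    simp [extendShift_add]
  simp only [h₁, h₂, hB.map_comp, mul_smul_comm]

theorem factorial_smul_wedge {p q : ℕ} {A B : Op V} (hA : IsSkew p A) (hB : IsSkew q B)
    (x : ℕ → V) :
    (p.factorial * q.factorial) • wedge p q A B x =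
      altSum (p + q) (fun y => A y * B fun j => y (p + j)) x := by
  rw [altSum_eq_unshuffleSum (skewOn_mul_left B hA.2) (skewOn_mul_right hA.1 hB),
    wedge_eq_unshuffleSum hA.1 hB.1]

theorem oddOn_mul {p q : ℕ} {A B : Op V} (hA : DependsOn p A) (hA' : OddOn p A)
    (hB' : OddOn q B) : OddOn (p + q) fun y => A y * B fun j => y (p + j) := by
  intro i hi y v
  rcases Nat.lt_or_ge i p with h | h
  · have h' : ∀ w, (fun j => Function.update y i w (p + j)) = fun j => y (p + j) := by
      intro w
      funext j
      exact Function.update_of_ne (by omega) _ _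
    simp only [h', hA' i h, neg_mul]
  · obtain ⟨l, rfl⟩ := Nat.exists_eq_add_of_le h
    have h₁ : ∀ w, A (Function.update y (p + l) w) = A y := fun w =>
      hA.congr fun j hj => Function.update_of_ne (by omega) _ _
    have h₂ : ∀ w, (fun j => Function.update y (p + l) w (p + j)) =
        Function.update (fun j => y (p + j)) l w := by
      intro w
      funext j
      simp [Function.update_apply]
    simp only [h₁, h₂, hB' l (by omega), mul_neg]

theorem isSkew_wedge [IsAddTorsionFree V] {p q : ℕ} {A B : Op V} (hA : IsSkew p A)
    (hB : IsSkew q B) : IsSkew (p + q) (wedge p q A B) := by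
  refine ⟨dependsOn_wedge p q A B, skewOn_of_nsmul (m := p.factorial * q.factorial)
    (by positivity) ?_⟩
  simp only [factorial_smul_wedge hA hB]
  exact skewOn_altSum _ _

theorem oddOn_wedge [IsAddTorsionFree V] {p q : ℕ} {A B : Op V} (hA : IsSkew p A)
    (hB : IsSkew q B) (hA' : OddOn p A) (hB' : OddOn q B) : OddOn (p + q) (wedge p q A B) := by
  refine oddOn_of_nsmul (m := p.factorial * q.factorial) (by positivity) ?_
  simp only [factorial_smul_wedge hA hB]
  exact oddOn_altSum (oddOn_mul hA.1 hA' hB')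

theorem factorial_smul_nrIns {m r : ℕ} {A C : Op V} (hA : IsSkew (m + 1) A)
    (hA' : OddOn (m + 1) A) (hC : IsSkew r C) (x : ℕ → V) :
    (r.factorial * m.factorial) • nrIns (m + 1) r A C x =
      altSum (r + m) (fun y => A (consV (C y) fun j => y (r + j))) x := by
  rw [altSum_eq_unshuffleSum, nrIns_eq_unshuffleSum hA.1 hC.1]
  · intro ρ y
    have h : (fun j => (y ∘ extendShift 0 ρ) (r + j)) = fun j => y (r + j) := by
      funext j
      simp [extendShift_of_le 0 ρ (show 0 + r ≤ r + j by omega)]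
    simp only [h, hC.2 ρ y]
    rcases Int.units_eq_one_or (Equiv.Perm.sign ρ) with h | h <;> simp [h, hA'.map_consV_neg]
  · intro ρ y
    have h : C (y ∘ extendShift r ρ) = C y :=
      hC.1.congr fun i hi => by simp [extendShift_of_lt r ρ hi]
    simp only [h, consV_comp_extendShift, hA.2.of_succ ρ]

theorem isSkew_nrIns [IsAddTorsionFree V] {m r : ℕ} {A C : Op V} (hA : IsSkew (m + 1) A)
    (hA' : OddOn (m + 1) A) (hC : IsSkew r C) : IsSkew (r + m) (nrIns (m + 1) r A C) := by
  refine ⟨dependsOn_nrIns m r A C, skewOn_of_nsmul (m := r.factorial * m.factorial)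
    (by positivity) ?_⟩
  simp only [factorial_smul_nrIns hA hA' hC]
  exact skewOn_altSum _ _

theorem factorial_smul_wedge_nrIns_left [IsAddTorsionFree V] {m q r : ℕ} {A B C : Op V}
    (hA : IsSkew (m + 1) A) (hA' : OddOn (m + 1) A) (hB : IsSkew q B) (hC : IsSkew r C)
    (x : ℕ → V) :
    (r.factorial * m.factorial * q.factorial) • wedge (r + m) q (nrIns (m + 1) r A C) B x =
      altSum (r + m + q)
        (fun y => A (consV (C y) fun j => y (r + j)) * B fun j => y (r + m + j)) x := by
  apply nsmul_right_injective (r + m).factorial_ne_zero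
  dsimp only
  rw [smul_smul, show (r + m).factorial * (r.factorial * m.factorial * q.factorial) =
    r.factorial * m.factorial * ((r + m).factorial * q.factorial) by ring, mul_smul,
    factorial_smul_wedge (isSkew_nrIns hA hA' hC) hB, ← altSum_smul,
    ← altSum_sum_extendShift (show 0 + (r + m) ≤ r + m + q by omega)]
  congr 1
  funext y
  rw [← smul_mul_assoc, factorial_smul_nrIns hA hA' hC, altSum, Finset.sum_mul]
  refine Finset.sum_congr rfl fun ρ _ => ?_
  have h : (fun j => (y ∘ extendShift 0 ρ) (r + m + j)) = fun j => y (r + m + j) := by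
    funext j
    simp [extendShift_of_le 0 ρ (show 0 + (r + m) ≤ r + m + j by omega)]
  simp only [h]
  rw [smul_mul_assoc, extendShift_zero]

theorem factorial_smul_wedge_nrIns_right [IsAddTorsionFree V] {p m r : ℕ} {A B C : Op V}
    (hA : IsSkew p A) (hB : IsSkew (m + 1) B) (hB' : OddOn (m + 1) B) (hC : IsSkew r C)
    (x : ℕ → V) :
    (p.factorial * r.factorial * m.factorial) • wedge p (r + m) A (nrIns (m + 1) r B C) x =
      altSum (p + (r + m))
        (fun y => A y * B (consV (C fun j => y (p + j)) fun j => y (p + (r + j)))) x := by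
  apply nsmul_right_injective (r + m).factorial_ne_zero
  dsimp only
  rw [smul_smul, show (r + m).factorial * (p.factorial * r.factorial * m.factorial) =
    r.factorial * m.factorial * (p.factorial * (r + m).factorial) by ring, mul_smul,
    factorial_smul_wedge hA (isSkew_nrIns hB hB' hC), ← altSum_smul,
    ← altSum_sum_extendShift (show p + (r + m) ≤ p + (r + m) by omega)]
  congr 1
  funext y
  rw [← mul_smul_comm, factorial_smul_nrIns hB hB' hC, altSum, Finset.mul_sum]
  refine Finset.sum_congr rfl fun ρ _ => ?_
  have h : A (y ∘ extendShift p ρ) = A y :=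
    hA.1.congr fun i hi => by simp [extendShift_of_lt p ρ hi]
  simp only [h, Function.comp_apply, extendShift_add, mul_smul_comm]
  rfl

/-- Antisymmetrizing a skew expression in which one argument is a value `C y` splits according
to the block of arguments in which `C y` is placed. -/
theorem altSum_altSum_consV {p q M r : ℕ} (hM : p + q = M + 1) {H C : Op V}
    (h₁ : SkewOn 0 p H) (h₂ : SkewOn p q H) (hC : DependsOn r C)
    (β : Equiv.Perm (Fin (M + 1))) (hβ : 0 < q → extendNat β p = 0) (x : ℕ → V) :
    altSum (r + M) (fun y => altSum (M + 1) H (consV (C y) fun j => y (r + j))) x =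
      M.factorial • (p • altSum (r + M) (fun y => H (consV (C y) fun j => y (r + j))) x +
        q • ((Equiv.Perm.sign β : ℤˣ) : ℤ) •
          altSum (r + M) (fun y => H ((consV (C y) fun j => y (r + j)) ∘ extendNat β)) x) := by
  set T : Equiv.Perm (Fin (M + 1)) → V := fun τ => ((Equiv.Perm.sign τ : ℤˣ) : ℤ) •
    altSum (r + M) (fun y => H ((consV (C y) fun j => y (r + j)) ∘ extendNat τ)) x with hT
  have hleft : ∀ σ τ : Equiv.Perm (Fin (M + 1)), σ 0 = 0 → T (σ * τ) = T τ := by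
    intro σ τ hσ
    obtain ⟨⟨i, ρ⟩, rfl⟩ := Equiv.Perm.decomposeFin.symm.surjective σ
    obtain rfl : i = 0 := by simpa using hσ
    have hext : extendNat (Equiv.Perm.decomposeFin.symm (0, ρ)) = extendShift 1 ρ := by
      funext j
      rcases j with _ | j
      · rw [extendNat_of_lt _ M.succ_pos, extendShift_of_lt _ _ one_pos]
        exact congrArg Fin.val (Equiv.Perm.decomposeFin_symm_apply_zero 0 ρ)
      rw [add_comm j, extendShift_add]
      rcases Nat.lt_or_ge j M with hj | hj
      · rw [extendNat_of_lt _ (by omega), extendNat_of_lt _ hj]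
        have := congrArg Fin.val (Equiv.Perm.decomposeFin_symm_apply_succ ρ 0 ⟨j, hj⟩)
        simpa [add_comm] using this
      · rw [extendNat_of_le _ (by omega), extendNat_of_le _ hj]
    have hsign : Equiv.Perm.sign (Equiv.Perm.decomposeFin.symm (0, ρ)) = Equiv.Perm.sign ρ := by
      simp
    have key := altSum_comp_extendShift (le_refl (r + M))
      (fun y => H ((consV (C y) fun j => y (r + j)) ∘ extendNat τ)) ρ x
    have hCy : ∀ y : ℕ → V, C (y ∘ extendShift r ρ) = C y := fun y =>
      hC.congr fun i hi => by simp [extendShift_of_lt r ρ hi]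
    simp only [hCy, consV_comp_extendShift] at key
    simp only [hT, extendNat_mul, hext, map_mul, hsign, ← Function.comp_assoc, key]
    rw [mul_comm, Units.val_mul, mul_smul, sign_smul_sign_smul]
  have hfix : ∀ (i : Fin (M + 1)) (τ τ' : Equiv.Perm (Fin (M + 1))), τ i = 0 → τ' i = 0 →
      T τ = T τ' := by
    intro i τ τ' h h'
    have := hleft (τ * τ'⁻¹) τ' (by
      rw [Equiv.Perm.mul_apply, Equiv.Perm.inv_eq_iff_eq.2 h'.symm, h])
    rwa [inv_mul_cancel_right] at this
  have hblock : ∀ s n, s + n ≤ M + 1 → SkewOn s n H → ∀ i j : Fin (M + 1),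
      s ≤ i → (i : ℕ) < s + n → s ≤ j → (j : ℕ) < s + n →
      ∀ τ τ' : Equiv.Perm (Fin (M + 1)), τ i = 0 → τ' j = 0 → T τ = T τ' := by
    intro s n hsn hH i j hi hi' hj hj' τ τ' h h'
    obtain ⟨ρ, hρ, hs⟩ := exists_extendNat_eq_extendShift s hsn
      (Equiv.swap ⟨j - s, by omega⟩ ⟨i - s, by omega⟩)
    have hval : ρ j = i := by
      ext
      have := congrFun hρ j
      rw [extendNat_of_lt _ j.2] at this
      rw [this]
      obtain ⟨l, hl⟩ := Nat.exists_eq_add_of_le hj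
      simp only [hl, extendShift_add, Nat.add_sub_cancel_left]
      rw [extendNat_of_lt _ (by omega), Equiv.swap_apply_left]
      simp only
      omega
    rw [← hfix j (τ * ρ) τ' (by rw [Equiv.Perm.mul_apply, hval, h]) h']
    simp only [hT, extendNat_mul, hρ, map_mul, ← Function.comp_assoc, hH _ _, altSum_zsmul]
    rw [smul_smul, ← hs, Units.val_mul, mul_assoc, ← Units.val_mul (Equiv.Perm.sign ρ),
      Int.units_mul_self, Units.val_one, mul_one]
  have hone : altSum (r + M) (fun y => H (consV (C y) fun j => y (r + j))) x = T 1 := by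
    have : extendNat (1 : Equiv.Perm (Fin (M + 1))) = id := funext extendNat_one
    simp [hT, this]
  have hval : ∀ (i : Fin (M + 1)) (τ : Equiv.Perm (Fin (M + 1))), τ i = 0 →
      T τ = if (i : ℕ) < p then T 1 else T β := by
    intro i τ h
    split_ifs with hi
    · exact hblock 0 p (by omega) h₁ i 0 (by simp) (by omega) (by simp)
        (by simp only [Fin.val_zero]; omega) τ 1 h rfl
    · refine hblock p q (by omega) h₂ i ⟨p, by omega⟩ (by omega) (by omega) le_rfl
        (by simp only; omega) τ β h ?_
      ext
      have := hβ (by omega)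
      rwa [extendNat_of_lt _ (by omega)] at this
  have hcount : ∀ g : Fin (M + 1) → V,
      ∑ t : Fin (M + 1) × Equiv.Perm (Fin M), g t.1 = M.factorial • ∑ i, g i := by
    intro g
    simp [Fintype.sum_prod_type_right, Fintype.card_perm]
  have hsplit : ∀ u v : V,
      (∑ i ∈ Finset.range (M + 1), if i < p then u else v) = p • u + q • v := by
    intro u v
    rw [← hM, Finset.sum_range_add,
      Finset.sum_congr rfl fun i hi => if_pos (Finset.mem_range.1 hi)]
    simp
  calc altSum (r + M) (fun y => altSum (M + 1) H (consV (C y) fun j => y (r + j))) x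
      = ∑ τ, T τ := by
        simp only [hT, ← altSum_zsmul, ← altSum_sum]
        rfl
    _ = ∑ τ : Equiv.Perm (Fin (M + 1)), T τ⁻¹ := (Equiv.sum_comp (Equiv.inv _) T).symm
    _ = ∑ t : Fin (M + 1) × Equiv.Perm (Fin M), T (Equiv.Perm.decomposeFin.symm t)⁻¹ :=
        (Equiv.sum_comp Equiv.Perm.decomposeFin.symm fun τ => T τ⁻¹).symm
    _ = ∑ t : Fin (M + 1) × Equiv.Perm (Fin M), if (t.1 : ℕ) < p then T 1 else T β := by
        refine Finset.sum_congr rfl fun t _ => hval _ _ ?_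
        rw [Equiv.Perm.inv_eq_iff_eq]
        exact (Equiv.Perm.decomposeFin_symm_apply_zero t.1 t.2).symm
    _ = _ := by
        rw [hcount fun i => if (i : ℕ) < p then T 1 else T β,
          Fin.sum_univ_eq_sum_range (fun i => if i < p then T 1 else T β), hsplit, hone]

theorem wedge_nrIns_zero_left (n q r : ℕ) (A B C : Op V) (x : ℕ → V) :
    wedge n q (nrIns 0 r A C) B x = 0 := by
  simp [wedge, nrIns]

theorem wedge_nrIns_zero_right (p n r : ℕ) (A B C : Op V) (x : ℕ → V) :
    wedge p n A (nrIns 0 r B C) x = 0 := by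
  simp [wedge, nrIns]

theorem smul_altSum_left_eq [IsAddTorsionFree V] {p q M r : ℕ} (hM : p + q = M + 1)
    {A B C : Op V} (hA : IsSkew p A) (hA' : OddOn p A) (hB : IsSkew q B) (hC : IsSkew r C)
    (x : ℕ → V) :
    p • altSum (r + M) (fun y => A (consV (C y) fun j => y (r + j)) *
      B fun j => consV (C y) (fun j => y (r + j)) (p + j)) x =
    (p.factorial * q.factorial * r.factorial) • wedge (p + r - 1) q (nrIns p r A C) B x := by
  rcases p with _ | m
  · rw [wedge_nrIns_zero_left, zero_smul, smul_zero]
  rw [show m + 1 + r - 1 = r + m by omega, Nat.factorial_succ,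
    show (m + 1) * m.factorial * q.factorial * r.factorial =
      (m + 1) * (r.factorial * m.factorial * q.factorial) by ring, mul_smul,
    factorial_smul_wedge_nrIns_left hA hA' hB hC, show r + m + q = r + M by omega]
  congr 3
  funext y
  congr 2
  funext j
  rw [consV, if_neg (by omega)]
  congr 1
  omega

theorem smul_altSum_right_eq [IsAddTorsionFree V] {p q M r : ℕ} (hM : p + q = M + 1)
    {A B C : Op V} (hA : IsSkew p A) (hB : IsSkew q B) (hB' : OddOn q B) (hC : IsSkew r C)
    {β : Equiv.Perm (Fin (M + 1))} (hβ : Equiv.Perm.sign β = (-1) ^ (p * q))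
    (hβ₁ : ∀ i < p, extendNat β i = q + i) (hβ₂ : ∀ j < q, extendNat β (p + j) = j)
    (x : ℕ → V) :
    q • ((Equiv.Perm.sign β : ℤˣ) : ℤ) • altSum (r + M) (fun y =>
      A ((consV (C y) fun j => y (r + j)) ∘ extendNat β) *
        B fun j => ((consV (C y) fun j => y (r + j)) ∘ extendNat β) (p + j)) x =
    (p.factorial * q.factorial * r.factorial) • (((-1) ^ (r * p + p) : ℤˣ) : ℤ) •
      wedge p (q + r - 1) A (nrIns q r B C) x := by
  rcases q with _ | m
  · rw [wedge_nrIns_zero_right, zero_smul, smul_zero, smul_zero]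
  obtain ⟨γ, hγ, hγ₁, hγ₂⟩ := exists_block_rotation (r + m) p
  have hleft : ∀ y : ℕ → V, A ((consV (C y) fun j => y (r + j)) ∘ extendNat β) *
      B (fun j => ((consV (C y) fun j => y (r + j)) ∘ extendNat β) (p + j)) =
      A (fun j => y (r + m + j)) * B (consV (C y) fun j => y (r + j)) := by
    intro y
    congr 1
    · refine hA.1.congr fun i hi => ?_
      rw [Function.comp_apply, hβ₁ i hi, consV, if_neg (by omega)]
      congr 1
      omega
    · exact hB.1.congr fun i hi => by rw [Function.comp_apply, hβ₂ i hi]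
  have hright : ∀ y : ℕ → V, A y * B (consV (C fun j => y (p + j)) fun j => y (p + (r + j))) =
      A (fun j => (y ∘ extendNat γ) (r + m + j)) *
        B (consV (C (y ∘ extendNat γ)) fun j => (y ∘ extendNat γ) (r + j)) := by
    intro y
    have hCy : C (fun j => y (p + j)) = C (y ∘ extendNat γ) :=
      hC.1.congr fun i hi => by rw [Function.comp_apply, hγ₁ i (by omega)]
    congr 1
    · exact hA.1.congr fun i hi => by rw [Function.comp_apply, hγ₂ i hi]
    · refine hB.1.congr fun i hi => ?_
      rcases i with _ | i
      · exact hCy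
      · simp only [consV, Nat.add_sub_cancel, if_neg i.succ_ne_zero, Function.comp_apply]
        rw [hγ₁ _ (by omega)]
  have key := factorial_smul_wedge_nrIns_right hA hB hB' hC x
  rw [show p + (r + m) = r + m + p by omega] at key
  simp only [hright] at key
  rw [altSum_comp_extendNat (fun y =>
    A (fun j => y (r + m + j)) * B (consV (C y) fun j => y (r + j)))] at key
  simp only [hleft]
  rw [show m + 1 + r - 1 = r + m by omega, show r + M = r + m + p by omega, Nat.factorial_succ,
    show p.factorial * ((m + 1) * m.factorial) * r.factorial =
      (m + 1) * (p.factorial * r.factorial * m.factorial) by ring, mul_smul,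
    smul_comm (p.factorial * r.factorial * m.factorial), key, smul_smul _ _ (altSum _ _ _),
    ← Units.val_mul, hβ, hγ, ← pow_add]
  congr 3
  rw [show r * p + p + (r + m) * p = p * (m + 1) + (r * p + r * p) by ring, pow_add,
    (Even.add_self (r * p)).neg_one_pow, mul_one]

theorem nrIns_wedge [IsAddTorsionFree V] {p q r : ℕ} {A B C : Op V} (hA : IsSkew p A)
    (hA' : OddOn p A) (hB : IsSkew q B) (hB' : OddOn q B) (hC : IsSkew r C) (x : ℕ → V) :
    nrIns (p + q) r (wedge p q A B) C x =
      wedge (p + r - 1) q (nrIns p r A C) B x +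
        (((-1) ^ (r * p + p) : ℤˣ) : ℤ) • wedge p (q + r - 1) A (nrIns q r B C) x := by
  rcases Nat.eq_zero_or_pos (p + q) with h | h
  · obtain ⟨rfl, rfl⟩ : p = 0 ∧ q = 0 := by omega
    rw [wedge_nrIns_zero_left, wedge_nrIns_zero_right, smul_zero, add_zero]
    simp [nrIns]
  obtain ⟨M, hM⟩ : ∃ M, p + q = M + 1 := ⟨p + q - 1, by omega⟩
  have hW := isSkew_wedge hA hB
  have hW' := oddOn_wedge hA hB hA' hB'
  have hrot := exists_block_rotation p q
  rw [hM] at hW hW' hrot ⊢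
  obtain ⟨β, hβ, hβ₁, hβ₂⟩ := hrot
  have hexp := altSum_altSum_consV hM (skewOn_mul_left B hA.2) (skewOn_mul_right hA.1 hB) hC.1 β
    (fun hq => hβ₂ 0 hq) x
  rw [smul_altSum_left_eq hM hA hA' hB hC, smul_altSum_right_eq hM hA hB hB' hC hβ hβ₁ hβ₂,
    ← smul_add, ← hM] at hexp
  simp only [← factorial_smul_wedge hA hB] at hexp
  rw [altSum_smul, ← factorial_smul_nrIns hW hW' hC, smul_smul, smul_smul,
    show p.factorial * q.factorial * (r.factorial * M.factorial) =
      M.factorial * (p.factorial * q.factorial * r.factorial) by ring] at hexp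
  exact nsmul_right_injective (by positivity) hexp

end Products

/-- the insertion identity
`i_C(A∧B) = (i_C A)∧B + (−1)^{c(a+1)} A∧(i_C B)` for alternating maps. -/
theorem statement9 (k V : Type*) [Field k] [CharZero k]
    [CommRing V] [Algebra k V]
    (a b c : ℤ) (ha : -1 ≤ a) (hb : -1 ≤ b) (hc : -1 ≤ c)
    (A B C : Op V) (hA : MemA k a A) (hB : MemA k b B) (hC : MemA k c C) :
    nrIns (ar (a + b + 1)) (ar c) (wedge (ar a) (ar b) A B) C =
      wedge (ar (a + c)) (ar b) (nrIns (ar a) (ar c) A C) B +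
        (((-1 : ℤˣ) ^ (c * (a + 1)) : ℤˣ) : ℤ) •
          wedge (ar a) (ar (b + c)) A (nrIns (ar b) (ar c) B C) := by
  have : IsAddTorsionFree V := by
    have : Module ℚ V := Module.compHom V (algebraMap ℚ k)
    exact .of_module_rat V
  funext x
  have key := nrIns_wedge (isSkew_of_memA hA) (oddOn_of_isMultilinearOn hA.1) (isSkew_of_memA hB)
    (oddOn_of_isMultilinearOn hB.1) (isSkew_of_memA hC) x
  have hab : ar (a + b + 1) = ar a + ar b := by simp only [ar]; omega
  have hac : ar (a + c) = ar a + ar c - 1 := by simp only [ar]; omega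
  have hbc : ar (b + c) = ar b + ar c - 1 := by simp only [ar]; omega
  have hsign : ((-1 : ℤˣ) ^ (c * (a + 1))) = (-1) ^ (ar c * ar a + ar a) := by
    have ha' : (ar a : ℤ) = a + 1 := by simp only [ar]; omega
    have hc' : (ar c : ℤ) = c + 1 := by simp only [ar]; omega
    rw [← zpow_natCast, show ((ar c * ar a + ar a : ℕ) : ℤ) = c * (a + 1) + 2 * (a + 1) by
      push_cast [ha', hc']; ring, zpow_add, (even_two_mul (a + 1)).neg_one_zpow, mul_one]
  rw [hab, hac, hbc, hsign, key]
  rfl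

end JacobiRevisited
end
end

section
/- On first-order multidifferential operators the Nijenhuis–Richardson bracket satisfies the generalized (Jacobi-type) Leibniz rule: for all A ∈ ADiff_1^a(V), B ∈ ADiff_1^b(V), C ∈ ADiff_1^c(V), [A, B∧C]^{NR} = [A,B]^{NR}∧C + (−1)^{a(b+1)} B∧[A,C]^{NR} − (−1)^a (i_1 A)∧B∧C, where i_1 A = A(1,·,…,·). -/
/-!  Common framework: operations of degree `a ≥ -1` on a vector space `V`
(i.e. `(a+1)`-linear maps `V^{a+1} → V`) are encoded as raw functions
`(ℕ → V) → V` depending only on the first `a+1` entries of the argument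
sequence, together with explicit multilinearity/alternation predicates. -/

noncomputable section
open scoped Classical

namespace JacobiRevisited

section Unshuffles

/-- The permutation of `Fin (n + 1)` sending `j` to `0` and acting as `τ` on the remaining
positions and values. -/
def extendPerm {n : ℕ} (j : Fin (n + 1)) (τ : Equiv.Perm (Fin n)) : Equiv.Perm (Fin (n + 1)) :=
  Equiv.Perm.decomposeFin.symm (0, τ) * j.cycleRange

theorem extendPerm_self {n : ℕ} (j : Fin (n + 1)) (τ : Equiv.Perm (Fin n)) :
    extendPerm j τ j = 0 := by
  simp [extendPerm]

theorem extendPerm_succAbove {n : ℕ} (j : Fin (n + 1)) (τ : Equiv.Perm (Fin n)) (i : Fin n) :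
    extendPerm j τ (j.succAbove i) = (τ i).succ := by
  simp [extendPerm]

theorem extendPerm_of_lt {n : ℕ} (j : Fin (n + 1)) (τ : Equiv.Perm (Fin n)) (i : ℕ)
    (hi : i < n) (hij : i < j) (h : i < n + 1) :
    extendPerm j τ ⟨i, h⟩ = (τ ⟨i, hi⟩).succ := by
  rw [← extendPerm_succAbove j, Fin.succAbove_of_castSucc_lt _ _ (by simpa [Fin.lt_def] using hij)]
  rfl

theorem extendPerm_succ_of_le {n : ℕ} (j : Fin (n + 1)) (τ : Equiv.Perm (Fin n)) (i : ℕ)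
    (hi : i < n) (hij : j ≤ i) (h : i + 1 < n + 1) :
    extendPerm j τ ⟨i + 1, h⟩ = (τ ⟨i, hi⟩).succ := by
  rw [← extendPerm_succAbove j, Fin.succAbove_of_le_castSucc _ _ (by simpa [Fin.le_def] using hij)]
  rfl

theorem sign_extendPerm {n : ℕ} (j : Fin (n + 1)) (τ : Equiv.Perm (Fin n)) :
    Equiv.Perm.sign (extendPerm j τ) = (-1) ^ (j : ℕ) * Equiv.Perm.sign τ := by
  simp [extendPerm, Fin.sign_cycleRange, mul_comm]

theorem extendPerm_injective {n : ℕ} (j : Fin (n + 1)) :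
    Function.Injective (extendPerm j) := by
  intro τ τ' h
  ext1 i
  have := congrArg (fun σ => σ (j.succAbove i)) h
  simpa [extendPerm_succAbove] using this

theorem exists_extendPerm_eq {n : ℕ} (j : Fin (n + 1)) (σ : Equiv.Perm (Fin (n + 1)))
    (h : σ j = 0) : ∃ τ, extendPerm j τ = σ := by
  obtain ⟨⟨i, τ⟩, hτ⟩ := Equiv.Perm.decomposeFin.symm.surjective (σ * j.cycleRange⁻¹)
  have hi : i = 0 := by
    have := congrArg (fun ρ => ρ 0) hτ
    rw [← Fin.cycleRange_self j] at this
    simpa [h] using this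
  subst hi
  exact ⟨τ, by rw [extendPerm, hτ]; simp⟩

theorem extendPerm_zero_mem {n p : ℕ} (τ : Equiv.Perm (Fin n)) :
    extendPerm 0 τ ∈ Unshuffles (n + 1) (p + 1) ↔ τ ∈ Unshuffles n p := by
  simp only [Unshuffles, Finset.mem_filter, Finset.mem_univ, true_and]
  have e0 := extendPerm_self 0 τ
  have es : ∀ i : Fin n, extendPerm 0 τ i.succ = (τ i).succ := fun i => by
    simpa using extendPerm_succAbove 0 τ i
  constructor
  · rintro ⟨h1, h2⟩
    constructor
    · intro i j hij hj
      simpa [es] using h1 i.succ j.succ (by simpa using hij) (by simpa using hj)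
    · intro i j hij hi
      simpa [es] using h2 i.succ j.succ (by simpa using hij) (by simpa using hi)
  · rintro ⟨h1, h2⟩
    constructor
    · intro i j hij hj
      cases j using Fin.cases with
      | zero => simp at hij
      | succ j =>
        cases i using Fin.cases with
        | zero => simp [e0, es]
        | succ i => simpa [es] using h1 i j (by simpa using hij) (by simpa using hj)
    · intro i j hij hi
      cases j using Fin.cases with
      | zero => simp at hij
      | succ j =>
        cases i using Fin.cases with
        | zero => simp at hi
        | succ i => simpa [es] using h2 i j (by simpa using hij) (by simpa using hi)

theorem extendPerm_mem {n p : ℕ} (hp : p < n + 1) (τ : Equiv.Perm (Fin n)) :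
    extendPerm ⟨p, hp⟩ τ ∈ Unshuffles (n + 1) p ↔ τ ∈ Unshuffles n p := by
  simp only [Unshuffles, Finset.mem_filter, Finset.mem_univ, true_and]
  have e0 := extendPerm_self ⟨p, hp⟩ τ
  have e1 : ∀ (i : ℕ) (h : i < n + 1) (hi : i < p),
      extendPerm ⟨p, hp⟩ τ ⟨i, h⟩ = (τ ⟨i, by omega⟩).succ := fun i h hi =>
    extendPerm_of_lt _ τ i (by omega) hi h
  have e2 : ∀ (i : ℕ) (h : i + 1 < n + 1) (hi : p ≤ i),
      extendPerm ⟨p, hp⟩ τ ⟨i + 1, h⟩ = (τ ⟨i, by omega⟩).succ := fun i h hi =>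
    extendPerm_succ_of_le _ τ i (by omega) hi h
  constructor
  · rintro ⟨h1, h2⟩
    constructor
    · rintro ⟨i, hi⟩ ⟨j, hj⟩ hij hjp
      simp only at hij hjp
      have := h1 ⟨i, by omega⟩ ⟨j, by omega⟩ hij hjp
      rwa [e1 i _ (by omega), e1 j _ hjp, Fin.succ_lt_succ_iff] at this
    · rintro ⟨i, hi⟩ ⟨j, hj⟩ hij hip
      simp only at hij hip
      have := h2 ⟨i + 1, by omega⟩ ⟨j + 1, by omega⟩ (by simpa using hij) (by simp; omega)
      rwa [e2 i _ hip, e2 j _ (by omega), Fin.succ_lt_succ_iff] at this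
  · rintro ⟨h1, h2⟩
    constructor
    · rintro ⟨i, hi⟩ ⟨j, hj⟩ hij hjp
      simp only at hij hjp
      rw [e1 i _ (by omega), e1 j _ hjp, Fin.succ_lt_succ_iff]
      exact h1 _ _ hij hjp
    · rintro ⟨i, hi⟩ ⟨j, hj⟩ hij hip
      simp only at hij hip
      obtain ⟨j, rfl⟩ : ∃ j', j = j' + 1 := ⟨j - 1, by omega⟩
      rw [e2 j _ (by omega)]
      rcases hip.eq_or_lt with rfl | hip
      · rw [e0]
        exact Fin.succ_pos _
      · obtain ⟨i, rfl⟩ : ∃ i', i = i' + 1 := ⟨i - 1, by omega⟩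
        rw [e2 i _ (by omega), Fin.succ_lt_succ_iff]
        exact h2 _ _ (by simpa using hij) (by simpa using Nat.lt_succ_iff.mp hip)

theorem sum_filter_unshuffles_eq {M : Type*} [AddCommMonoid M] {n p q : ℕ} (j : Fin (n + 1))
    (hmem : ∀ τ, extendPerm j τ ∈ Unshuffles (n + 1) p ↔ τ ∈ Unshuffles n q)
    (f : Equiv.Perm (Fin (n + 1)) → M) :
    ∑ σ ∈ (Unshuffles (n + 1) p).filter (fun σ => σ j = 0), f σ =
      ∑ τ ∈ Unshuffles n q, f (extendPerm j τ) := by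
  symm
  refine Finset.sum_nbij (extendPerm j) ?_ ((extendPerm_injective j).injOn) ?_ (fun _ _ => rfl)
  · intro τ hτ
    rw [Finset.mem_filter]
    exact ⟨(hmem τ).2 hτ, extendPerm_self j τ⟩
  · intro σ hσ
    rw [Finset.mem_coe, Finset.mem_filter] at hσ
    obtain ⟨τ, rfl⟩ := exists_extendPerm_eq j σ hσ.2
    exact ⟨τ, (hmem τ).1 hσ.1, rfl⟩

/-- In an unshuffle the value `0` is taken at the start of one of the two blocks. -/
theorem apply_eq_zero_of_mem_unshuffles {n p : ℕ} {σ : Equiv.Perm (Fin (n + 1))}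
    (hσ : σ ∈ Unshuffles (n + 1) p) : (0 < p ∧ σ 0 = 0) ∨ ∃ h : p < n + 1, σ ⟨p, h⟩ = 0 := by
  simp only [Unshuffles, Finset.mem_filter, Finset.mem_univ, true_and] at hσ
  obtain ⟨h1, h2⟩ := hσ
  obtain ⟨j, hj⟩ := σ.surjective 0
  by_cases hjp : (j : ℕ) < p
  · left
    refine ⟨by omega, ?_⟩
    by_cases h0 : j = 0
    · rwa [h0] at hj
    · have := h1 0 j (by simpa using Fin.pos_iff_ne_zero.2 h0) hjp
      rw [hj] at this
      exact absurd this (Fin.not_lt_zero _)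
  · right
    have hp : p < n + 1 := by omega
    refine ⟨hp, ?_⟩
    by_cases h0 : j = ⟨p, hp⟩
    · rw [← h0, hj]
    · have hne : (j : ℕ) ≠ p := fun h => h0 (Fin.ext h)
      have := h2 ⟨p, hp⟩ j (by simp only; omega) le_rfl
      rw [hj] at this
      exact absurd this (Fin.not_lt_zero _)

theorem sum_unshuffles_zero {M : Type*} [AddCommMonoid M] (n : ℕ)
    (f : Equiv.Perm (Fin (n + 1)) → M) :
    ∑ σ ∈ Unshuffles (n + 1) 0, f σ = ∑ τ ∈ Unshuffles n 0, f (extendPerm 0 τ) := by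
  rw [← sum_filter_unshuffles_eq 0 (fun τ => extendPerm_mem (Nat.succ_pos n) τ),
    Finset.filter_true_of_mem]
  intro σ hσ
  rcases apply_eq_zero_of_mem_unshuffles hσ with ⟨h, _⟩ | ⟨h, h'⟩
  · omega
  · exact h'

theorem sum_unshuffles_self {M : Type*} [AddCommMonoid M] (n : ℕ)
    (f : Equiv.Perm (Fin (n + 1)) → M) :
    ∑ σ ∈ Unshuffles (n + 1) (n + 1), f σ = ∑ τ ∈ Unshuffles n n, f (extendPerm 0 τ) := by
  rw [← sum_filter_unshuffles_eq 0 (fun τ => extendPerm_zero_mem τ),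
    Finset.filter_true_of_mem]
  intro σ hσ
  rcases apply_eq_zero_of_mem_unshuffles hσ with ⟨_, h⟩ | ⟨h, _⟩
  · exact h
  · omega

theorem sum_unshuffles_succ {M : Type*} [AddCommMonoid M] {n p : ℕ} (hp : p + 1 < n + 1)
    (f : Equiv.Perm (Fin (n + 1)) → M) :
    ∑ σ ∈ Unshuffles (n + 1) (p + 1), f σ =
      ∑ τ ∈ Unshuffles n p, f (extendPerm 0 τ) +
        ∑ τ ∈ Unshuffles n (p + 1), f (extendPerm ⟨p + 1, hp⟩ τ) := by
  rw [← sum_filter_unshuffles_eq 0 (fun τ => extendPerm_zero_mem τ),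
    ← sum_filter_unshuffles_eq ⟨p + 1, hp⟩ (fun τ => extendPerm_mem hp τ),
    ← Finset.sum_filter_add_sum_filter_not _ (fun σ => σ 0 = 0)]
  congr 2
  apply Finset.filter_congr
  intro σ hσ
  constructor
  · intro h
    rcases apply_eq_zero_of_mem_unshuffles hσ with ⟨_, h'⟩ | ⟨_, h'⟩
    · exact absurd h' h
    · exact h'
  · intro h h'
    have := σ.injective (h.trans h'.symm)
    simp [Fin.ext_iff] at this

end Unshuffles

section ShuffleSum

variable {V : Type*} [CommRing V]

/-- The signed sum of `G u w` over all ways of splitting a list into two complementary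
subsequences `u` and `w`. -/
def shuffleSum : List V → (List V → List V → V) → V
  | [], G => G [] []
  | x :: l, G => shuffleSum l (fun u w => G (x :: u) w) +
      shuffleSum l (fun u w => (-1) ^ u.length * G u (x :: w))

theorem shuffleSum_congr {l : List V} {G H : List V → List V → V}
    (h : ∀ u w, u.length + w.length = l.length → G u w = H u w) :
    shuffleSum l G = shuffleSum l H := by
  induction l generalizing G H with
  | nil => exact h [] [] rfl
  | cons x l ih =>
    rw [shuffleSum, shuffleSum]
    congr 1
    · refine ih fun u w huw => h _ _ ?_
      simp only [List.length_cons]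
      omega
    · refine ih fun u w huw => ?_
      rw [h]
      simp only [List.length_cons]
      omega

theorem shuffleSum_add (l : List V) (G H : List V → List V → V) :
    shuffleSum l (fun u w => G u w + H u w) = shuffleSum l G + shuffleSum l H := by
  induction l generalizing G H with
  | nil => rfl
  | cons x l ih =>
    simp only [shuffleSum, mul_add, ih]
    ring

theorem map_shuffleSum (φ : V →+ V) (l : List V) (G : List V → List V → V) :
    φ (shuffleSum l G) = shuffleSum l (fun u w => φ (G u w)) := by
  induction l generalizing G with
  | nil => rfl
  | cons x l ih =>
    simp only [shuffleSum, map_add, ih]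
    congr 2
    funext u w
    rcases neg_one_pow_eq_or V u.length with h | h <;> simp [h]

theorem mul_shuffleSum (c : V) (l : List V) (G : List V → List V → V) :
    c * shuffleSum l G = shuffleSum l (fun u w => c * G u w) :=
  map_shuffleSum (AddMonoidHom.mulLeft c) l G

theorem shuffleSum_mul (c : V) (l : List V) (G : List V → List V → V) :
    shuffleSum l G * c = shuffleSum l (fun u w => G u w * c) :=
  map_shuffleSum (AddMonoidHom.mulRight c) l G

theorem shuffleSum_zero (l : List V) : shuffleSum l (fun _ _ => 0) = 0 :=
  (map_shuffleSum 0 l (fun _ _ => 0)).symm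

theorem shuffleSum_neg (l : List V) (G : List V → List V → V) :
    shuffleSum l (fun u w => -G u w) = -shuffleSum l G :=
  (map_shuffleSum (-AddMonoidHom.id V) l G).symm

theorem shuffleSum_eq_nil (l : List V) (G : List V → List V → V)
    (h : ∀ u w, u ≠ [] → G u w = 0) : shuffleSum l G = G [] l := by
  induction l generalizing G with
  | nil => rfl
  | cons x l ih =>
    have : (fun u w => G (x :: u) w) = fun _ _ => 0 := by
      funext u w
      exact h _ _ (by simp)
    rw [shuffleSum, this, shuffleSum_zero, ih]
    · simp
    · intro u w hu
      rw [h _ _ hu, mul_zero]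

theorem shuffleSum_swap (l : List V) (G : List V → List V → V) :
    shuffleSum l G = shuffleSum l (fun u w => (-1) ^ (u.length * w.length) * G w u) := by
  induction l generalizing G with
  | nil => simp [shuffleSum]
  | cons x l ih =>
    rw [shuffleSum, shuffleSum, ih, ih (fun u w => (-1) ^ u.length * G u (x :: w)), add_comm]
    congr 2
    · funext u w
      simp only [List.length_cons]
      ring
    · funext u w
      simp only [List.length_cons]
      rw [mul_add_one, pow_add]
      rcases neg_one_pow_eq_or V u.length with h | h <;> simp [h]

theorem shuffleSum_assoc (l : List V) (H : List V → List V → List V → V) :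
    shuffleSum l (fun u w => shuffleSum u (fun u₁ u₂ => H u₁ u₂ w)) =
      shuffleSum l (fun u w => shuffleSum w (fun w₁ w₂ => H u w₁ w₂)) := by
  induction l generalizing H with
  | nil => rfl
  | cons x l ih =>
    have hlast : shuffleSum l (fun u w => (-1) ^ u.length *
          shuffleSum u (fun u₁ u₂ => H u₁ u₂ (x :: w))) =
        shuffleSum l (fun u w => shuffleSum u (fun u₁ u₂ =>
          (-1) ^ u₁.length * ((-1) ^ u₂.length * H u₁ u₂ (x :: w)))) := by
      congr 1
      funext u w
      rw [mul_shuffleSum]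
      refine shuffleSum_congr fun u₁ u₂ h => ?_
      rw [← h, pow_add, mul_assoc]
    simp only [shuffleSum, shuffleSum_add, mul_add]
    rw [hlast, ih, ih (fun u₁ u₂ w => (-1) ^ u₁.length * H u₁ (x :: u₂) w),
      ih (fun u₁ u₂ w => (-1) ^ u₁.length * ((-1) ^ u₂.length * H u₁ u₂ (x :: w)))]
    simp only [← mul_shuffleSum]
    ring

theorem getD_cons_eq_consV (x : V) (l : List V) :
    (fun i => (x :: l).getD i 0) = consV x (fun i => l.getD i 0) := by
  funext i
  cases i <;> simp [consV]

/-- Signed sums over unshuffles, as signed sums over splittings of the list of arguments. -/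
theorem sum_unshuffles_eq_shuffleSum {n p : ℕ} (hp : p ≤ n) (G : (ℕ → V) → (ℕ → V) → V)
    (x : ℕ → V) :
    ∑ σ ∈ Unshuffles n p, ((Equiv.Perm.sign σ : ℤˣ) : ℤ) •
        G (fun i => if h : i < n then if i < p then x (σ ⟨i, h⟩) else 0 else 0)
          (fun j => if h : p + j < n then x (σ ⟨p + j, h⟩) else 0) =
      shuffleSum (List.ofFn fun i : Fin n => x i) (fun u w =>
        if u.length = p then G (fun i => u.getD i 0) (fun j => w.getD j 0) else 0) := by
  induction n generalizing p G x with
  | zero =>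
    obtain rfl : p = 0 := by omega
    simp [Unshuffles, shuffleSum]
  | succ n ih =>
    have hfst : ∀ q, p = q + 1 → ∀ τ : Equiv.Perm (Fin n),
        ((Equiv.Perm.sign (extendPerm 0 τ) : ℤˣ) : ℤ) •
          G (fun i => if h : i < n + 1 then if i < p then x (extendPerm 0 τ ⟨i, h⟩) else 0 else 0)
            (fun j => if h : p + j < n + 1 then x (extendPerm 0 τ ⟨p + j, h⟩) else 0) =
        ((Equiv.Perm.sign τ : ℤˣ) : ℤ) •
          G (consV (x 0)
              (fun i => if h : i < n then if i < q then x (τ ⟨i, h⟩ + 1) else 0 else 0))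
            (fun j => if h : q + j < n then x (τ ⟨q + j, h⟩ + 1) else 0) := by
      rintro q rfl τ
      rw [sign_extendPerm]
      simp only [Fin.val_zero, pow_zero, one_mul]
      congr 2
      · funext i
        cases i with
        | zero => simp [consV, extendPerm_self 0 τ]
        | succ i =>
          by_cases h : i < n
          · simp [consV, h, extendPerm_succ_of_le 0 τ i h (by simp)]
          · simp [consV, h]
      · funext j
        by_cases h : q + j < n
        · have h' : q + 1 + j < n + 1 := by omega
          have := extendPerm_succ_of_le 0 τ (q + j) h (by simp) (by omega)
          have e : (⟨q + 1 + j, h'⟩ : Fin (n + 1)) = ⟨q + j + 1, by omega⟩ :=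
            Fin.ext (by simp only; omega)
          rw [dif_pos h, dif_pos h', e, this, Fin.val_succ]
        · have h' : ¬ q + 1 + j < n + 1 := by omega
          simp only [h, h', dite_false]
    have hsnd : ∀ (hp' : p < n + 1) (τ : Equiv.Perm (Fin n)),
        ((Equiv.Perm.sign (extendPerm ⟨p, hp'⟩ τ) : ℤˣ) : ℤ) •
          G (fun i => if h : i < n + 1 then
                if i < p then x (extendPerm ⟨p, hp'⟩ τ ⟨i, h⟩) else 0 else 0)
            (fun j => if h : p + j < n + 1 then x (extendPerm ⟨p, hp'⟩ τ ⟨p + j, h⟩) else 0) =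
        ((Equiv.Perm.sign τ : ℤˣ) : ℤ) • ((-1) ^ p *
          G (fun i => if h : i < n then if i < p then x (τ ⟨i, h⟩ + 1) else 0 else 0)
            (consV (x 0) (fun j => if h : p + j < n then x (τ ⟨p + j, h⟩ + 1) else 0))) := by
      intro hp' τ
      rw [sign_extendPerm]
      have h1 : (fun i => if h : i < n + 1 then
                if i < p then x (extendPerm ⟨p, hp'⟩ τ ⟨i, h⟩) else 0 else 0) =
          (fun i => if h : i < n then if i < p then x (τ ⟨i, h⟩ + 1) else 0 else 0) := by
        funext i
        by_cases h : i < p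
        · have h2 : i < n := by omega
          have h3 : i < n + 1 := by omega
          simp [h, h2, h3, extendPerm_of_lt ⟨p, hp'⟩ τ i h2 h]
        · simp [h]
      have h2 : (fun j => if h : p + j < n + 1 then x (extendPerm ⟨p, hp'⟩ τ ⟨p + j, h⟩) else 0) =
          consV (x 0) (fun j => if h : p + j < n then x (τ ⟨p + j, h⟩ + 1) else 0) := by
        funext j
        cases j with
        | zero => simp [consV, hp', extendPerm_self]
        | succ j =>
          by_cases h : p + j < n
          · have h' : p + (j + 1) < n + 1 := by omega
            have := extendPerm_succ_of_le ⟨p, hp'⟩ τ (p + j) h (by simp) (by omega)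
            rw [dif_pos h']
            simp only [← add_assoc, this, Fin.val_succ, consV]
            simp [h]
          · have h' : ¬ p + (j + 1) < n + 1 := by omega
            simp [h, h', consV]
      rw [h1, h2]
      simp only [zsmul_eq_mul]
      push_cast
      ring
    have ih1 : ∀ q, q ≤ n → _ := fun q hq =>
      ih hq (fun u w => G (consV (x 0) u) w) (fun i => x (i + 1))
    have ih2 : p ≤ n → _ := fun hq =>
      ih hq (fun u w => (-1) ^ p * G u (consV (x 0) w)) (fun i => x (i + 1))
    have hcons : shuffleSum (List.ofFn fun i : Fin (n + 1) => x i) (fun u w =>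
        if u.length = p then G (fun i => u.getD i 0) (fun j => w.getD j 0) else 0) =
      shuffleSum (List.ofFn fun i : Fin n => x (i + 1)) (fun u w =>
        if u.length + 1 = p then G (consV (x 0) (fun i => u.getD i 0)) (fun j => w.getD j 0)
          else 0) +
      shuffleSum (List.ofFn fun i : Fin n => x (i + 1)) (fun u w =>
        if u.length = p then
          (-1) ^ p * G (fun i => u.getD i 0) (consV (x 0) (fun j => w.getD j 0)) else 0) := by
      rw [List.ofFn_succ, shuffleSum]
      simp only [Fin.val_zero, Fin.val_succ, List.length_cons, getD_cons_eq_consV]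
      congr 2
      funext u w
      split_ifs with h <;> simp [h]
    rw [hcons]
    rcases Nat.eq_zero_or_pos p with rfl | hpos
    · rw [sum_unshuffles_zero, Finset.sum_congr rfl fun τ _ => hsnd (by omega) τ, ih2 (by omega)]
      simp [shuffleSum_zero]
    · obtain ⟨q, rfl⟩ : ∃ q, p = q + 1 := ⟨p - 1, by omega⟩
      rcases hp.eq_or_lt with h | hlt
      · obtain rfl : q = n := by omega
        rw [sum_unshuffles_self, Finset.sum_congr rfl fun τ _ => hfst q rfl τ, ih1 q le_rfl]
        simp only [Nat.add_right_cancel_iff]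
        rw [left_eq_add]
        refine (shuffleSum_congr ?_).trans (shuffleSum_zero (List.ofFn fun i : Fin q => x (i + 1)))
        refine fun u w h => if_neg ?_
        rw [List.length_ofFn] at h
        omega
      · rw [sum_unshuffles_succ hlt, Finset.sum_congr rfl fun τ _ => hfst q rfl τ,
          Finset.sum_congr rfl fun τ _ => hsnd hlt τ, ih1 q (by omega), ih2 (by omega)]
        simp only [Nat.add_right_cancel_iff]

/-- An `n`-ary operation as a function on argument lists, extended by zero to lists of a
length different from `n`. -/
def onList (n : ℕ) (A : Op V) (l : List V) : V :=
  if l.length = n then A (fun i => l.getD i 0) else 0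

theorem onList_of_length_ne {n : ℕ} {A : Op V} {l : List V} (h : l.length ≠ n) :
    onList n A l = 0 := if_neg h

theorem onList_cons (n : ℕ) (A : Op V) (v : V) (l : List V) :
    onList n A (v :: l) =
      if l.length + 1 = n then A (consV v (fun i => l.getD i 0)) else 0 := by
  rw [onList, getD_cons_eq_consV, List.length_cons]

theorem onList_add_cons {k : Type*} [CommRing k] [Algebra k V] {n : ℕ} {A : Op V}
    (hA : IsMultilinearOn k n A) (v v' : V) (l : List V) :
    onList n A ((v + v') :: l) = onList n A (v :: l) + onList n A (v' :: l) := by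
  simp only [onList_cons]
  split_ifs with h
  · have key : ∀ v, consV v (fun i => l.getD i 0) =
        Function.update (consV 0 (fun i => l.getD i 0)) 0 v := by
      intro v
      funext i
      cases i <;> simp [consV]
    rw [key (v + v'), key v, key v']
    exact (hA.2 0 (by omega)).2 _ _ _
  · simp

theorem onList_zero_cons {k : Type*} [CommRing k] [Algebra k V] {n : ℕ} {A : Op V}
    (hA : IsMultilinearOn k n A) (l : List V) : onList n A (0 :: l) = 0 := by
  simpa using onList_add_cons hA 0 0 l

theorem onList_mul_cons {k : Type*} [CommRing k] [Algebra k V] {a : ℤ} {A : Op V}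
    (hA : MemADiff1 k a A) (f g : V) (l : List V) :
    onList (ar a) A ((f * g) :: l) = f * onList (ar a) A (g :: l) +
      g * onList (ar a) A (f :: l) - f * g * onList (ar a) A (1 :: l) := by
  simp only [onList_cons]
  split_ifs with h
  · exact hA.2.2 (by unfold ar at h; omega) f g _
  · simp

/-- The wedge product of functions on argument lists. -/
def listWedge (F G : List V → V) (l : List V) : V :=
  shuffleSum l (fun u w => F u * G w)

/-- The Nijenhuis–Richardson insertion `i_G F` for functions on argument lists. -/
def listIns (F G : List V → V) (l : List V) : V :=
  shuffleSum l (fun u w => F (G u :: w))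

/-- The sign `(-1) ^ n` in `V`. -/
def sgn (V : Type*) [CommRing V] (n : ℤ) : V := (((-1 : ℤˣ) ^ n : ℤˣ) : ℤ)

theorem sgn_add (m n : ℤ) : sgn V (m + n) = sgn V m * sgn V n := by
  simp [sgn, zpow_add]

theorem sgn_natCast (n : ℕ) : sgn V n = (-1) ^ n := by
  simp [sgn]

theorem sgn_congr {m n : ℤ} (h : Even (m - n)) : sgn V m = sgn V n := by
  have := (Int.negOnePow_eq_iff m n).2 h
  rw [Int.negOnePow_def, Int.negOnePow_def] at this
  rw [sgn, sgn, this]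

/-- The Nijenhuis–Richardson bracket for functions on argument lists. -/
def listBracket (a b : ℤ) (F G : List V → V) (l : List V) : V :=
  -listIns G F l + sgn V (a * b) * listIns F G l

/-- `F` vanishes on lists whose length is not `a + 1`. -/
def HasDegree (a : ℤ) (F : List V → V) : Prop :=
  ∀ l : List V, (l.length : ℤ) ≠ a + 1 → F l = 0

theorem hasDegree_onList {a : ℤ} (ha : -1 ≤ a) (A : Op V) : HasDegree a (onList (ar a) A) := by
  intro l hl
  refine onList_of_length_ne ?_
  unfold ar
  omega

theorem HasDegree.listIns {a b : ℤ} {F G : List V → V} (hF : HasDegree a F)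
    (hF0 : ∀ l, F (0 :: l) = 0) (hG : HasDegree b G) : HasDegree (a + b) (listIns F G) := by
  intro l hl
  refine (shuffleSum_congr fun u w huw => ?_).trans (shuffleSum_zero l)
  by_cases hu : (u.length : ℤ) = b + 1
  · refine hF _ ?_
    simp only [List.length_cons]
    push_cast
    omega
  · rw [hG u hu, hF0]

theorem HasDegree.listBracket {a b : ℤ} {F G : List V → V} (hF : HasDegree a F)
    (hF0 : ∀ l, F (0 :: l) = 0) (hG : HasDegree b G) (hG0 : ∀ l, G (0 :: l) = 0) :
    HasDegree (a + b) (listBracket a b F G) := by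
  intro l hl
  rw [JacobiRevisited.listBracket, hF.listIns hF0 hG l hl,
    hG.listIns hG0 hF l (by rwa [add_comm b a])]
  simp

/-- Insertion into a wedge product is a graded derivation. -/
theorem listIns_listWedge {a b : ℤ} {A B C : List V → V} (hA : HasDegree a A)
    (hB : HasDegree b B) (hC : ∀ l, C (0 :: l) = 0) (l : List V) :
    listIns (listWedge B C) A l = listWedge (listIns B A) C l +
      sgn V (a * (b + 1)) * listWedge B (listIns C A) l := by
  have h1 : listWedge (listIns B A) C l = shuffleSum l (fun u w =>
      shuffleSum w (fun w₁ w₂ => B (A u :: w₁) * C w₂)) := by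
    rw [← shuffleSum_assoc l (fun u w₁ w₂ => B (A u :: w₁) * C w₂)]
    simp only [listWedge, listIns, shuffleSum_mul]
  have h2 : sgn V (a * (b + 1)) * listWedge B (listIns C A) l = shuffleSum l (fun u w =>
      shuffleSum w (fun w₁ w₂ => (-1) ^ w₁.length * (B w₁ * C (A u :: w₂)))) := by
    rw [← shuffleSum_assoc l (fun u w₁ w₂ => (-1) ^ w₁.length * (B w₁ * C (A u :: w₂)))]
    simp only [listWedge, listIns, mul_shuffleSum]
    rw [← shuffleSum_assoc l (fun u w₁ w₂ => sgn V (a * (b + 1)) * (B u * C (A w₁ :: w₂)))]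
    congr 1
    funext u w
    rw [shuffleSum_swap u (fun u₁ u₂ => (-1) ^ u₂.length * (B u₂ * C (A u₁ :: w)))]
    congr 1
    funext u₁ u₂
    by_cases hu₁ : (u₁.length : ℤ) = b + 1
    · by_cases hu₂ : (u₂.length : ℤ) = a + 1
      · have : sgn V (a * (b + 1)) = (-1) ^ (u₁.length * u₂.length) * (-1) ^ u₁.length := by
          rw [← pow_add, ← sgn_natCast]
          refine sgn_congr ⟨-(b + 1), ?_⟩
          push_cast
          rw [hu₁, hu₂]
          ring
        rw [this, mul_assoc]
      · simp [hA u₂ hu₂, hC]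
    · simp [hB u₁ hu₁]
  rw [h1, h2, ← shuffleSum_add]
  simp only [← shuffleSum_add]
  simp only [listIns, listWedge, shuffleSum, shuffleSum_add]

/-- Insertion of a wedge product into a first-order operator. -/
theorem listIns_listWedge_right {a b c : ℤ} {A B C : List V → V} (hA : HasDegree a A)
    (hB : HasDegree b B) (hC : HasDegree c C)
    (hadd : ∀ v v' l, A ((v + v') :: l) = A (v :: l) + A (v' :: l))
    (hmul : ∀ f g l, A ((f * g) :: l) =
      f * A (g :: l) + g * A (f :: l) - f * g * A (1 :: l)) (l : List V) :
    listIns A (listWedge B C) l = listWedge B (listIns A C) l +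
      sgn V (a * (c + 1)) * listWedge (listIns A B) C l -
      sgn V (a * (b + c)) * listWedge (listWedge (fun w => A (1 :: w)) B) C l := by
  have h1 : listWedge B (listIns A C) l = shuffleSum l (fun u w =>
      shuffleSum u (fun u₁ u₂ => B u₁ * A (C u₂ :: w))) := by
    rw [shuffleSum_assoc l (fun u₁ u₂ w => B u₁ * A (C u₂ :: w))]
    simp only [listWedge, listIns, mul_shuffleSum]
  have h2 : sgn V (a * (c + 1)) * listWedge (listIns A B) C l = shuffleSum l (fun u w =>
      shuffleSum u (fun u₁ u₂ => C u₂ * A (B u₁ :: w))) := by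
    rw [shuffleSum_assoc l (fun u₁ u₂ w => C u₂ * A (B u₁ :: w))]
    simp only [listWedge, listIns, mul_shuffleSum, shuffleSum_mul]
    rw [shuffleSum_assoc l (fun u₁ u₂ w => sgn V (a * (c + 1)) * (A (B u₁ :: u₂) * C w))]
    congr 1
    funext u w
    rw [shuffleSum_swap w (fun w₁ w₂ => C w₁ * A (B u :: w₂))]
    congr 1
    funext w₁ w₂
    by_cases hw₂ : (w₂.length : ℤ) = c + 1
    · by_cases hw₁ : (w₁.length : ℤ) = a
      · rw [← sgn_natCast, mul_comm (C w₂)]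
        push_cast
        rw [hw₁, hw₂]
      · rw [hA (B u :: w₁) (by simp only [List.length_cons]; push_cast; omega)]
        simp
    · simp [hC w₂ hw₂]
  have h3 : sgn V (a * (b + c)) * listWedge (listWedge (fun w => A (1 :: w)) B) C l =
      shuffleSum l (fun u w => shuffleSum u (fun u₁ u₂ => B u₁ * C u₂ * A (1 :: w))) := by
    rw [shuffleSum_swap]
    simp only [listWedge, mul_shuffleSum, shuffleSum_mul]
    rw [shuffleSum_assoc l (fun u₁ u₂ w => sgn V (a * (b + c)) * (A (1 :: u₁) * B u₂ * C w))]
    congr 1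
    funext u w
    refine shuffleSum_congr fun w₁ w₂ hw => ?_
    by_cases hw₁ : (w₁.length : ℤ) = b + 1
    · by_cases hw₂ : (w₂.length : ℤ) = c + 1
      · by_cases hu : (u.length : ℤ) = a
        · have : sgn V (a * (b + c)) = (-1) ^ (u.length * w.length) := by
            rw [← sgn_natCast, ← hw]
            refine sgn_congr ⟨-a, ?_⟩
            push_cast
            rw [hw₁, hw₂, hu]
            ring
          rw [this]
          ring
        · rw [hA (1 :: u) (by simp only [List.length_cons]; push_cast; omega)]
          simp
      · simp [hC w₂ hw₂]
    · simp [hB w₁ hw₁]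
  have h0 : listIns A (listWedge B C) l = shuffleSum l (fun u w =>
      shuffleSum u (fun u₁ u₂ => A ((B u₁ * C u₂) :: w))) := by
    unfold listIns
    congr 1
    funext u w
    exact map_shuffleSum (AddMonoidHom.mk' (fun v => A (v :: w)) (fun v v' => hadd v v' w)) u _
  rw [h0, h1, h2, h3, sub_eq_add_neg]
  simp only [← shuffleSum_neg, ← shuffleSum_add]
  congr 1
  funext u w
  congr 1
  funext u₁ u₂
  rw [hmul]
  ring

/-- The generalized Leibniz rule for functions on argument lists. -/
theorem listBracket_listWedge {a b c : ℤ} {A B C : List V → V} (hA : HasDegree a A)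
    (hB : HasDegree b B) (hC : HasDegree c C) (hC0 : ∀ l, C (0 :: l) = 0)
    (hadd : ∀ v v' l, A ((v + v') :: l) = A (v :: l) + A (v' :: l))
    (hmul : ∀ f g l, A ((f * g) :: l) =
      f * A (g :: l) + g * A (f :: l) - f * g * A (1 :: l)) (l : List V) :
    listBracket a (b + c + 1) A (listWedge B C) l =
      listWedge (listBracket a b A B) C l +
        sgn V (a * (b + 1)) * listWedge B (listBracket a c A C) l -
        sgn V a * listWedge (listWedge (fun w => A (1 :: w)) B) C l := by
  have h1 : listWedge (listBracket a b A B) C l =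
      -listWedge (listIns B A) C l + sgn V (a * b) * listWedge (listIns A B) C l := by
    simp only [listWedge, listBracket, add_mul, shuffleSum_add, neg_mul, shuffleSum_neg,
      mul_assoc, mul_shuffleSum]
  have h2 : listWedge B (listBracket a c A C) l =
      -listWedge B (listIns C A) l + sgn V (a * c) * listWedge B (listIns A C) l := by
    simp only [listWedge, listBracket, mul_add, shuffleSum_add, mul_neg, shuffleSum_neg,
      mul_left_comm (B _), mul_shuffleSum]
  rw [listBracket, listIns_listWedge hA hB hC0, listIns_listWedge_right hA hB hC hadd hmul, h1, h2]
  have s1 : sgn V (a * (b + c + 1)) = sgn V (a * (b + 1)) * sgn V (a * c) := by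
    rw [← sgn_add]
    ring_nf
  have s2 : sgn V (a * (b + c + 1)) * sgn V (a * (c + 1)) = sgn V (a * b) := by
    rw [← sgn_add]
    exact sgn_congr ⟨a * (c + 1), by ring⟩
  have s3 : sgn V (a * (b + c + 1)) * sgn V (a * (b + c)) = sgn V a := by
    rw [← sgn_add]
    exact sgn_congr ⟨a * (b + c), by ring⟩
  linear_combination listWedge B (listIns A C) l * s1 + listWedge (listIns A B) C l * s2 -
    listWedge (listWedge (fun w => A (1 :: w)) B) C l * s3

theorem wedge_apply_eq_listWedge (p q : ℕ) (A B : Op V) (x : ℕ → V) :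
    wedge p q A B x =
      listWedge (onList p A) (onList q B) (List.ofFn fun i : Fin (p + q) => x i) := by
  have key := sum_unshuffles_eq_shuffleSum (Nat.le_add_right p q) (fun u w => A u * B w) x
  have hl : wedge p q A B x = _ := (Finset.sum_congr rfl fun σ _ => ?_).trans key
  · rw [hl]
    refine shuffleSum_congr fun u w h => ?_
    rw [List.length_ofFn] at h
    by_cases hu : u.length = p
    · simp [onList, hu, show w.length = q by omega]
    · simp [onList, hu]
  · congr 3
    · funext i
      by_cases h : i < p
      · simp [h, show i < p + q by omega]
      · simp [h]
    · funext j
      simp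

theorem nrIns_apply_eq_listIns {p q : ℕ} {A : Op V} (hA : ∀ l, onList p A (0 :: l) = 0)
    (B : Op V) (x : ℕ → V) :
    nrIns p q A B x =
      listIns (onList p A) (onList q B) (List.ofFn fun i : Fin (p + q - 1) => x i) := by
  rcases Nat.eq_zero_or_pos p with rfl | hp
  · simp [nrIns, listIns, onList_cons, shuffleSum_zero]
  have key := sum_unshuffles_eq_shuffleSum (show q ≤ p + q - 1 by omega)
    (fun u w => A (consV (B u) w)) x
  have hl : nrIns p q A B x = _ :=
    (dif_neg hp.ne').trans ((Finset.sum_congr rfl fun σ _ => ?_).trans key)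
  · rw [hl]
    refine shuffleSum_congr fun u w h => ?_
    rw [List.length_ofFn] at h
    by_cases hu : u.length = q
    · rw [onList_cons, if_pos hu, if_pos (by omega), onList, if_pos hu]
    · rw [onList_of_length_ne hu, hA, if_neg hu]
  · congr 2
    funext j
    cases j with
    | zero =>
      simp only [dite_true, consV, if_true]
      congr 1
      funext i
      by_cases h : i < q
      · simp [h, show i < p + q - 1 by omega]
      · simp [h]
    | succ j =>
      by_cases h : j + 1 < p
      · have h' : q + j < p + q - 1 := by omega
        simp [consV, h, h', ← add_assoc]
      · have h' : ¬ q + j < p + q - 1 := by omega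
        simp [consV, h, h']

theorem onList_eq_of_apply_eq {n : ℕ} {A : Op V} {F : List V → V}
    (hF : ∀ l : List V, l.length ≠ n → F l = 0)
    (h : ∀ x, A x = F (List.ofFn fun i : Fin n => x i)) : onList n A = F := by
  funext l
  by_cases hl : l.length = n
  · subst hl
    rw [onList, if_pos rfl, h]
    congr 1
    apply List.ext_getElem <;> simp
  · rw [onList_of_length_ne hl, hF l hl]

theorem onList_wedge (p q : ℕ) (A B : Op V) :
    onList (p + q) (wedge p q A B) = listWedge (onList p A) (onList q B) := by
  refine onList_eq_of_apply_eq (fun l hl => ?_) (wedge_apply_eq_listWedge p q A B)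
  refine (shuffleSum_congr fun u w h => ?_).trans (shuffleSum_zero l)
  by_cases hu : u.length = p
  · rw [onList_of_length_ne (l := w) (by omega), mul_zero]
  · rw [onList_of_length_ne hu, zero_mul]

theorem listIns_eq_zero_of_degree_neg_one {F : List V → V} (hF : HasDegree (-1) F)
    (G : List V → V) (l : List V) : listIns F G l = 0 := by
  refine (shuffleSum_congr fun u w _ => hF _ ?_).trans (shuffleSum_zero l)
  simp only [List.length_cons]
  push_cast
  omega

theorem nrIns_apply_eq_listIns_ar {a b : ℤ} (ha : -1 ≤ a) (hb : -1 ≤ b) {A : Op V}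
    (hA : ∀ l, onList (ar a) A (0 :: l) = 0) (B : Op V) (x : ℕ → V) :
    nrIns (ar a) (ar b) A B x =
      listIns (onList (ar a) A) (onList (ar b) B) (List.ofFn fun i : Fin (ar (a + b)) => x i) := by
  rw [nrIns_apply_eq_listIns hA]
  rcases ha.eq_or_lt with rfl | ha'
  · rw [listIns_eq_zero_of_degree_neg_one (hasDegree_onList le_rfl A),
      listIns_eq_zero_of_degree_neg_one (hasDegree_onList le_rfl A)]
  · rw [show ar a + ar b - 1 = ar (a + b) by unfold ar; omega]

theorem nrBracket_apply_eq_listBracket {a b : ℤ} (ha : -1 ≤ a) (hb : -1 ≤ b) {A B : Op V}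
    (hA : ∀ l, onList (ar a) A (0 :: l) = 0) (hB : ∀ l, onList (ar b) B (0 :: l) = 0)
    (x : ℕ → V) :
    nrBracket a b A B x = listBracket a b (onList (ar a) A) (onList (ar b) B)
      (List.ofFn fun i : Fin (ar (a + b)) => x i) := by
  simp only [nrBracket, listBracket, Pi.add_apply, Pi.neg_apply, Pi.smul_apply]
  rw [nrIns_apply_eq_listIns_ar ha hb hA, nrIns_apply_eq_listIns_ar hb ha hB, add_comm b a,
    zsmul_eq_mul, sgn]

theorem listBracket_neg_one {F G : List V → V} (hF : HasDegree (-1) F) (hG : HasDegree (-1) G)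
    (l : List V) : listBracket (-1) (-1) F G l = 0 := by
  simp [listBracket, listIns_eq_zero_of_degree_neg_one hF, listIns_eq_zero_of_degree_neg_one hG]

theorem onList_nrBracket {a b : ℤ} (ha : -1 ≤ a) (hb : -1 ≤ b) {A B : Op V}
    (hA : ∀ l, onList (ar a) A (0 :: l) = 0) (hB : ∀ l, onList (ar b) B (0 :: l) = 0) :
    onList (ar (a + b)) (nrBracket a b A B) =
      listBracket a b (onList (ar a) A) (onList (ar b) B) := by
  refine onList_eq_of_apply_eq (fun l hl => ?_) (nrBracket_apply_eq_listBracket ha hb hA hB)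
  by_cases h : a = -1 ∧ b = -1
  · obtain ⟨rfl, rfl⟩ := h
    exact listBracket_neg_one (hasDegree_onList le_rfl A) (hasDegree_onList le_rfl B) l
  · refine (hasDegree_onList ha A).listBracket hA (hasDegree_onList hb B) hB l ?_
    unfold ar at hl
    omega

theorem iUnit_eq_zero (A : Op V) : iUnit (-1) A = 0 := by
  funext x
  simp [iUnit, nrIns, ar]

theorem onList_iUnit {a : ℤ} (ha : -1 ≤ a) {A : Op V}
    (hA : ∀ l, onList (ar a) A (0 :: l) = 0) :
    onList (ar (a - 1)) (iUnit a A) = fun l => onList (ar a) A (1 :: l) := by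
  have h : ∀ l, onList (ar a) A (1 :: l) =
      listIns (onList (ar a) A) (onList 0 fun _ => 1) l := by
    intro l
    rw [listIns, shuffleSum_eq_nil]
    · rfl
    · intro u w hu
      rw [onList_of_length_ne (l := u) (by simpa using hu), hA]
  rcases ha.eq_or_lt with rfl | ha'
  · funext l
    rw [iUnit_eq_zero, onList_of_length_ne (l := 1 :: l) (by simp [ar])]
    simp [onList]
  · refine onList_eq_of_apply_eq (fun l hl => onList_of_length_ne ?_) fun x => ?_
    · simp only [List.length_cons]
      unfold ar at hl ⊢
      omega
    · rw [iUnit, nrIns_apply_eq_listIns hA, h, show ar a + 0 - 1 = ar (a - 1) by unfold ar; omega]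

end ShuffleSum

/-- on first-order multidifferential operators the
Nijenhuis–Richardson bracket satisfies the generalized (Jacobi-type) Leibniz
rule `[A,B∧C] = [A,B]∧C + (−1)^{a(b+1)} B∧[A,C] − (−1)^a (i_1 A)∧B∧C`. -/
theorem statement12 (k V : Type*) [Field k] [CharZero k]
    [CommRing V] [Algebra k V]
    (a b c : ℤ) (ha : -1 ≤ a) (hb : -1 ≤ b) (hc : -1 ≤ c)
    (A B C : Op V)
    (hA : MemADiff1 k a A) (hB : MemADiff1 k b B) (hC : MemADiff1 k c C) :
    nrBracket a (b + c + 1) A (wedge (ar b) (ar c) B C) =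
      wedge (ar (a + b)) (ar c) (nrBracket a b A B) C +
        (((-1 : ℤˣ) ^ (a * (b + 1)) : ℤˣ) : ℤ) •
          wedge (ar b) (ar (a + c)) B (nrBracket a c A C) -
        (((-1 : ℤˣ) ^ a : ℤˣ) : ℤ) •
          wedge (ar (a + b)) (ar c) (wedge (ar (a - 1)) (ar b) (iUnit a A) B) C := by
  have hA0 := onList_zero_cons hA.1
  have hB0 := onList_zero_cons hB.1
  have hC0 := onList_zero_cons hC.1
  have hAd := hasDegree_onList ha A
  have hBd := hasDegree_onList hb B
  have hCd := hasDegree_onList hc C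
  have hbc : ar (b + c + 1) = ar b + ar c := by unfold ar; omega
  have hW : onList (ar (b + c + 1)) (wedge (ar b) (ar c) B C) =
      listWedge (onList (ar b) B) (onList (ar c) C) := by
    rw [hbc, onList_wedge]
  have hW0 : ∀ l, onList (ar (b + c + 1)) (wedge (ar b) (ar c) B C) (0 :: l) = 0 := by
    intro l
    simp [hW, listWedge, shuffleSum, hB0, hC0, shuffleSum_zero]
  funext x
  simp only [Pi.add_apply, Pi.sub_apply, Pi.smul_apply]
  have h1 : wedge (ar (a + b)) (ar c) (nrBracket a b A B) C x =
      listWedge (listBracket a b (onList (ar a) A) (onList (ar b) B)) (onList (ar c) C)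
        (List.ofFn fun i : Fin (ar (a + (b + c + 1))) => x i) := by
    rw [wedge_apply_eq_listWedge, onList_nrBracket ha hb hA0 hB0]
    by_cases h : a = -1 ∧ b = -1
    · obtain ⟨rfl, rfl⟩ := h
      simp [listWedge, listBracket_neg_one hAd hBd, shuffleSum_zero]
    · rw [show ar (a + b) + ar c = ar (a + (b + c + 1)) by unfold ar; omega]
  have h2 : wedge (ar b) (ar (a + c)) B (nrBracket a c A C) x =
      listWedge (onList (ar b) B) (listBracket a c (onList (ar a) A) (onList (ar c) C))
        (List.ofFn fun i : Fin (ar (a + (b + c + 1))) => x i) := by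
    rw [wedge_apply_eq_listWedge, onList_nrBracket ha hc hA0 hC0]
    by_cases h : a = -1 ∧ c = -1
    · obtain ⟨rfl, rfl⟩ := h
      simp [listWedge, listBracket_neg_one hAd hCd, shuffleSum_zero]
    · rw [show ar b + ar (a + c) = ar (a + (b + c + 1)) by unfold ar; omega]
  have h3 : wedge (ar (a + b)) (ar c) (wedge (ar (a - 1)) (ar b) (iUnit a A) B) C x =
      listWedge (listWedge (fun w => onList (ar a) A (1 :: w)) (onList (ar b) B))
        (onList (ar c) C) (List.ofFn fun i : Fin (ar (a + (b + c + 1))) => x i) := by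
    rcases ha.eq_or_lt with rfl | ha'
    · have hz : ∀ w, onList (ar (-1)) A (1 :: w) = 0 := fun w =>
        onList_of_length_ne (by simp [ar])
      simp [wedge, iUnit_eq_zero, listWedge, hz, shuffleSum_zero]
    · rw [wedge_apply_eq_listWedge,
        show ar (a + b) = ar (a - 1) + ar b by unfold ar; omega, onList_wedge,
        onList_iUnit ha hA0,
        show ar (a - 1) + ar b + ar c = ar (a + (b + c + 1)) by unfold ar; omega]
  rw [h1, h2, h3, zsmul_eq_mul, zsmul_eq_mul,
    nrBracket_apply_eq_listBracket ha (by omega) hA0 hW0, hW]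
  exact listBracket_listWedge hAd hBd hCd hC0 (onList_add_cons hA.1) (onList_mul_cons hA) _

end JacobiRevisited
end
end
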